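/- Let K be a field with algebraic closure K̄, and let X be a scheme of finite type over K (the structure morphism X → Spec K is quasi-compact and locally of finite type) that is separated over K, whose underlying topological space is irreducible and has Krull dimension at least 1. Let x̄_1, …, x̄_n : Spec K̄ → X be finitely many K̄-points of X over K. Then there exists a closed irreducible subset C of the underlying topological space of X whose Krull dimension as a topological space equals 1 and which contains the image point of every x̄_i; equivalently, X contains an integral closed curve, defined over K, passing through the images of x̄_1, …, x̄_n. -/

import Mathlib

universe u

section AlgPart
open Polynomial



section Alg


section ModA
variable {K Ω : Type*} [Field K] [Field Ω] [Algebra K Ω]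

def GoodAt (K : Type*) {Ω : Type*} [Field K] [Field Ω] [Algebra K Ω]
    (V : ValuationSubring Ω) (φ : Ω) : Prop :=
  ∀ p : Polynomial K, p ≠ 0 → V.valuation (aeval φ p) = 1

lemma val_eq_one_mono {V W : ValuationSubring Ω} (h : V ≤ W) {x : Ω}
    (hx : V.valuation x = 1) : W.valuation x = 1 := by
  have hx0 : x ≠ 0 := by rintro rfl; simp at hx
  apply le_antisymm
  · rw [ValuationSubring.valuation_le_one_iff]
    exact h ((V.valuation_le_one_iff x).1 hx.le)
  · have : V.valuation x⁻¹ ≤ 1 := by simp [hx]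
    have := (W.valuation_le_one_iff _).2 (h ((V.valuation_le_one_iff _).1 this))
    rw [map_inv₀] at this
    have h0 : 0 < W.valuation x := zero_lt_iff.2 (by simpa using hx0)
    exact (inv_le_one₀ h0).1 this

lemma GoodAt.mono {V W : ValuationSubring Ω} (h : V ≤ W) {x : Ω} (hx : GoodAt K V x) :
    GoodAt K W x := fun p hp => val_eq_one_mono h (hx p hp)

lemma GoodAt.coe_le {V : ValuationSubring Ω} {φ : Ω} (hx : GoodAt K V φ) (k : K) :
    V.valuation (algebraMap K Ω k) ≤ 1 := by
  by_cases hk : k = 0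
  · simp [hk]
  · have := hx (C k) (by simpa using hk)
    rw [aeval_C] at this
    exact this.le

lemma val_poly_le {V : ValuationSubring Ω} (hK : ∀ k : K, V.valuation (algebraMap K Ω k) ≤ 1)
    {c : Ω} (hc : V.valuation c ≤ 1) (p : K[X]) : V.valuation (aeval c p) ≤ 1 := by
  rw [aeval_eq_sum_range]
  apply Valuation.map_sum_le
  intro i _
  rw [Algebra.smul_def, map_mul, map_pow]
  exact mul_le_one' (hK _) (pow_le_one' hc _)

lemma val_sub_one {V : ValuationSubring Ω} {x : Ω} (h : V.valuation (x - 1) < 1) :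
    V.valuation x = 1 := by
  have := Valuation.map_add_eq_of_lt_left V.valuation (x := 1) (y := x - 1) (by simpa using h)
  simpa using this

lemma val_monic_sub {V : ValuationSubring Ω} (hK : ∀ k : K, V.valuation (algebraMap K Ω k) ≤ 1)
    {c : Ω} (hc : 1 < V.valuation c) (p : K[X]) (hp : p.Monic) :
    V.valuation (aeval c p - c ^ p.natDegree) < V.valuation (c ^ p.natDegree) := by
  have hc0 : V.valuation c ≠ 0 := (zero_lt_one.trans hc).ne'
  rw [aeval_eq_sum_range, Finset.sum_range_succ, hp.coeff_natDegree, one_smul, add_sub_cancel_right]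
  apply Valuation.map_sum_lt
  · rw [map_pow]; exact pow_ne_zero _ hc0
  intro i hi
  rw [Algebra.smul_def, map_mul, map_pow, map_pow]
  calc _ ≤ 1 * V.valuation c ^ i := mul_le_mul_left (hK _) _
    _ < _ := by
      rw [one_mul]
      exact pow_lt_pow_right₀ hc (Finset.mem_range.1 hi)

/-- approximation polynomial -/
lemma exists_approx (S : Finset (ValuationSubring Ω))
    (hK : ∀ V ∈ S, ∀ k : K, V.valuation (algebraMap K Ω k) ≤ 1) (c : Ω) :
    ∃ f : K[X], f.Monic ∧ 0 < f.natDegree ∧ f.coeff 0 = 1 ∧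
      ∀ V ∈ S, V.valuation c ≤ 1 → V.valuation (aeval c f) = 1 := by
  classical
  have H : ∀ V : ValuationSubring Ω, ∃ g : K[X], g.Monic ∧
      ((∃ g : K[X], g.Monic ∧ V.valuation (aeval c g) < 1) → V.valuation (aeval c g) < 1) := by
    intro V
    by_cases h : ∃ g : K[X], g.Monic ∧ V.valuation (aeval c g) < 1
    · obtain ⟨g, hg, hg'⟩ := h
      exact ⟨g, hg, fun _ => hg'⟩
    · exact ⟨1, monic_one, fun h' => absurd h' h⟩
  choose g hg hg' using H
  have hm : (∏ V ∈ S, g V).Monic := monic_prod_of_monic _ _ fun V _ => hg V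
  have hXm : (X * ∏ V ∈ S, g V).Monic := monic_X.mul hm
  have hdeg : 0 < (X * ∏ V ∈ S, g V).natDegree := by
    rw [monic_X.natDegree_mul hm]; simp
  have hlt : (1 : K[X]).degree < (X * ∏ V ∈ S, g V).degree := by
    rw [degree_one, degree_eq_natDegree hXm.ne_zero]; exact_mod_cast hdeg
  have hfm := hXm.add_of_left hlt
  refine ⟨X * ∏ V ∈ S, g V + 1, hfm, ?_, by simp, ?_⟩
  · rw [natDegree_add_eq_left_of_degree_lt hlt]; exact hdeg
  · intro V hV hc
    by_cases h : ∃ g : K[X], g.Monic ∧ V.valuation (aeval c g) < 1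
    · apply val_sub_one
      rw [map_add, map_one, add_sub_cancel_right, map_mul, aeval_X, map_mul, map_prod,
        ← Finset.mul_prod_erase S _ hV]
      calc _ ≤ 1 * V.valuation (aeval c (g V) * _) := mul_le_mul_left hc _
        _ ≤ V.valuation (aeval c (g V)) * 1 := by
          rw [one_mul, map_mul]
          apply mul_le_mul_right
          rw [← map_prod]
          exact val_poly_le (hK V hV) hc _
        _ < 1 := by rw [mul_one]; exact hg' V h
    · push Not at h
      exact le_antisymm (val_poly_le (hK V hV) hc _) (h _ hfm)

lemma val_one_mul {V : ValuationSubring Ω} {ι : Type*} (s : Finset ι) (u : ι → Ω)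
    (hu : ∀ i ∈ s, V.valuation (u i - 1) < 1) : V.valuation (∏ i ∈ s, u i - 1) < 1 := by
  classical
  induction s using Finset.induction_on with
  | empty => simp
  | insert a s ha ih =>
    rw [Finset.prod_insert ha]
    have h1 := hu a (by simp)
    have h2 := ih fun i hi => hu i (by simp [hi])
    have : u a * ∏ i ∈ s, u i - 1 = u a * (∏ i ∈ s, u i - 1) + (u a - 1) := by ring
    rw [this]
    apply Valuation.map_add_lt _ _ h1
    rw [map_mul, val_sub_one h1, one_mul]; exact h2

lemma val_poly_congr {V : ValuationSubring Ω}
    (hK : ∀ k : K, V.valuation (algebraMap K Ω k) ≤ 1)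
    {x y : Ω} (hx : V.valuation x ≤ 1) (hy : V.valuation y ≤ 1)
    (hxy : V.valuation (x - y) < 1) (p : K[X]) :
    V.valuation (aeval x p - aeval y p) < 1 := by
  have hpow : ∀ n : ℕ, V.valuation (x ^ n - y ^ n) < 1 := by
    intro n
    induction n with
    | zero => simp
    | succ n ih =>
      have : x ^ (n + 1) - y ^ (n + 1) = x * (x ^ n - y ^ n) + (x - y) * y ^ n := by ring
      rw [this]
      apply Valuation.map_add_lt
      · rw [map_mul]; rw [mul_comm]; exact mul_lt_one_of_lt_of_le ih hx
      · rw [map_mul, map_pow]; exact mul_lt_one_of_lt_of_le hxy (pow_le_one' hy _)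
  induction p using Polynomial.induction_on' with
  | add p q hp hq =>
    have : aeval x (p + q) - aeval y (p + q) =
      (aeval x p - aeval y p) + (aeval x q - aeval y q) := by simp only [map_add]; ring
    rw [this]
    exact Valuation.map_add_lt _ hp hq
  | monomial n a =>
    rw [aeval_monomial, aeval_monomial, ← mul_sub, map_mul]
    rw [mul_comm]; exact mul_lt_one_of_lt_of_le (hpow n) (hK _)

lemma GoodAt.div {V : ValuationSubring Ω} {φ : Ω} (h : GoodAt K V φ) (f : K[X])
    (hf : f.coeff 0 = 1) : GoodAt K V (φ / aeval φ f) := by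
  intro p hp
  have hf0 : f ≠ 0 := by rintro rfl; simp at hf
  have hvf := h f hf0
  have hfφ : aeval φ f ≠ 0 := by intro h0; simp [h0] at hvf
  have hvφ : V.valuation φ = 1 := by simpa using h X X_ne_zero
  obtain ⟨p1, hp1, hp1'⟩ := Polynomial.exists_eq_pow_rootMultiplicity_mul_and_not_dvd p hp 0
  have hc : p1.coeff 0 ≠ 0 := by
    simpa [X_dvd_iff] using hp1'
  rw [hp1, map_mul, map_mul]
  have h1 : V.valuation (aeval (φ / aeval φ f) ((X - C 0 : K[X]) ^ rootMultiplicity 0 p)) = 1 := by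
    simp [hvφ, hvf]
  rw [h1, one_mul]
  let N := p1.natDegree
  let H : K[X] := ∑ i ∈ Finset.range (N + 1), C (p1.coeff i) * X ^ i * f ^ (N - i)
  have hH0 : H ≠ 0 := by
    intro h0
    have : H.coeff 0 = p1.coeff 0 := by
      simp only [H, coeff_zero_eq_eval_zero, eval_finsetSum]
      rw [Finset.sum_range_succ']
      have hf' : eval 0 f = 1 := by rw [← coeff_zero_eq_eval_zero, hf]
      simp [hf', coeff_zero_eq_eval_zero]
    rw [h0] at this
    exact hc (by simpa using this.symm)
  have hval : aeval (φ / aeval φ f) p1 * (aeval φ f) ^ N = aeval φ H := by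
    rw [aeval_eq_sum_range, Finset.sum_mul]
    simp only [H, map_sum]
    apply Finset.sum_congr rfl
    intro i hi
    have hi' : i ≤ N := Nat.lt_succ_iff.1 (Finset.mem_range.1 hi)
    obtain ⟨k, hk⟩ := Nat.exists_eq_add_of_le hi'
    rw [hk, Nat.add_sub_cancel_left]
    simp only [map_mul, map_pow, aeval_C, aeval_X, Algebra.smul_def, div_pow, pow_add]
    field_simp
  have := congrArg V.valuation hval
  rw [map_mul, map_pow, hvf, one_pow, mul_one, h H hH0] at this
  exact this

lemma exists_sep (S : Finset (ValuationSubring Ω))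
    (hK : ∀ V ∈ S, ∀ k : K, V.valuation (algebraMap K Ω k) ≤ 1)
    (V W : ValuationSubring Ω) (hV : V ∈ S) (hW : W ∈ S) (h1 : ¬ V ≤ W) (h2 : ¬ W ≤ V) :
    ∃ u : Ω, V.valuation (u - 1) < 1 ∧ W.valuation u < 1 ∧ ∀ U ∈ S, U.valuation u ≤ 1 := by
  obtain ⟨a, haV, haW⟩ := SetLike.not_le_iff_exists.1 h1
  obtain ⟨b, hbW, hbV⟩ := SetLike.not_le_iff_exists.1 h2
  rw [← ValuationSubring.valuation_le_one_iff] at haV haW hbW hbV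
  push Not at haW hbV
  have ha0 : a ≠ 0 := by rintro rfl; simp at haW
  let c := b / a
  have hcV : 1 < V.valuation c := by
    simp only [c, map_div₀]
    rw [one_lt_div₀ (zero_lt_iff.2 (by simpa using ha0))]
    exact haV.trans_lt hbV
  have hcW : W.valuation c < 1 := by
    simp only [c, map_div₀]
    rw [div_lt_one₀ (zero_lt_iff.2 (by simpa using ha0))]
    exact hbW.trans_lt haW
  obtain ⟨f, hf, hn, hf0, hfS⟩ := exists_approx S hK c
  have hbig : ∀ U ∈ S, 1 < U.valuation c →
      U.valuation (aeval c f) = U.valuation (c ^ f.natDegree) := by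
    intro U hU hc
    have := val_monic_sub (hK U hU) hc f hf
    have h3 := Valuation.map_add_eq_of_lt_left _ this
    simpa using h3
  refine ⟨c ^ f.natDegree / aeval c f, ?_, ?_, ?_⟩
  · have h3 := val_monic_sub (hK V hV) hcV f hf
    have h4 := hbig V hV hcV
    have h5 : V.valuation (aeval c f) ≠ 0 := by
      rw [h4, map_pow]; exact pow_ne_zero _ (zero_lt_one.trans hcV).ne'
    have h6 : aeval c f ≠ 0 := by intro h; simp [h] at h5
    rw [div_sub_one h6, map_div₀, div_lt_one₀ (zero_lt_iff.2 h5), Valuation.map_sub_swap, h4]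
    exact h3
  · rw [map_div₀, hfS W hW hcW.le, div_one, map_pow]
    exact pow_lt_one' hcW hn.ne'
  · intro U hU
    rcases le_or_gt (U.valuation c) 1 with h | h
    · rw [map_div₀, hfS U hU h, div_one, map_pow]
      exact pow_le_one' h _
    · rw [map_div₀, hbig U hU h]
      exact div_self_le_one _

lemma exists_common_antichain (S : Finset (ValuationSubring Ω))
    (hS : ∀ V ∈ S, ∀ W ∈ S, V ≠ W → ¬ V ≤ W) (φ : ValuationSubring Ω → Ω)
    (hφ : ∀ V ∈ S, GoodAt K V (φ V)) : ∃ ψ : Ω, ∀ V ∈ S, GoodAt K V ψ := by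
  classical
  have hK : ∀ V ∈ S, ∀ k : K, V.valuation (algebraMap K Ω k) ≤ 1 := fun V hV => (hφ V hV).coe_le
  have hu : ∀ V W : ValuationSubring Ω, ∃ u : Ω, V ∈ S → W ∈ S → V ≠ W →
      V.valuation (u - 1) < 1 ∧ W.valuation u < 1 ∧ ∀ U ∈ S, U.valuation u ≤ 1 := by
    intro V W
    by_cases h : V ∈ S ∧ W ∈ S ∧ V ≠ W
    · obtain ⟨u, hu⟩ := exists_sep S hK V W h.1 h.2.1 (hS _ h.1 _ h.2.1 h.2.2)
        (hS _ h.2.1 _ h.1 h.2.2.symm)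
      exact ⟨u, fun _ _ _ => hu⟩
    · exact ⟨0, fun a b c => absurd ⟨a, b, c⟩ h⟩
  choose u hu using hu
  have hf : ∀ V : ValuationSubring Ω, ∃ f : K[X], f.Monic ∧ 0 < f.natDegree ∧ f.coeff 0 = 1 ∧
      ∀ U ∈ S, U.valuation (φ V) ≤ 1 → U.valuation (aeval (φ V) f) = 1 :=
    fun V => exists_approx S hK (φ V)
  choose f hfm hfn hf0 hfS using hf
  let ψ : ValuationSubring Ω → Ω := fun V => φ V / aeval (φ V) (f V)
  have hψg : ∀ V ∈ S, GoodAt K V (ψ V) := fun V hV => (hφ V hV).div _ (hf0 V)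
  have hψ : ∀ V, ∀ U ∈ S, U.valuation (ψ V) ≤ 1 := by
    intro V U hU
    simp only [ψ]
    rcases le_or_gt (U.valuation (φ V)) 1 with h | h
    · rw [map_div₀, hfS V U hU h, div_one]; exact h
    · have := val_monic_sub (hK U hU) h (f V) (hfm V)
      have h3 := Valuation.map_add_eq_of_lt_left _ this
      rw [add_sub_cancel] at h3
      rw [map_div₀, h3, map_pow]
      apply div_le_one_of_le₀ _ (zero_le)
      exact le_self_pow₀ h.le (hfn V).ne'
  let e : ValuationSubring Ω → Ω := fun V => ∏ W ∈ S.erase V, u V W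
  have he1 : ∀ V ∈ S, V.valuation (e V - 1) < 1 := by
    intro V hV
    apply val_one_mul
    intro W hW
    exact (hu V W hV (Finset.mem_of_mem_erase hW) (Finset.ne_of_mem_erase hW).symm).1
  have he2 : ∀ V ∈ S, ∀ W ∈ S, V ≠ W → W.valuation (e V) < 1 := by
    intro V hV W hW hVW
    have hW' : W ∈ S.erase V := Finset.mem_erase.2 ⟨hVW.symm, hW⟩
    simp only [e]
    rw [← Finset.mul_prod_erase _ _ hW', map_mul]
    apply mul_lt_one_of_lt_of_le (hu V W hV hW hVW).2.1
    rw [map_prod]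
    apply Finset.prod_le_one'
    intro U hU
    have hU' := Finset.mem_of_mem_erase hU
    exact (hu V U hV (Finset.mem_of_mem_erase hU') (Finset.ne_of_mem_erase hU').symm).2.2 W hW
  refine ⟨∑ V ∈ S, e V * ψ V, fun V hV p hp => ?_⟩
  have hlt : V.valuation (∑ V ∈ S, e V * ψ V - ψ V) < 1 := by
    rw [← Finset.add_sum_erase _ _ hV]
    have : e V * ψ V + ∑ W ∈ S.erase V, e W * ψ W - ψ V =
      (e V - 1) * ψ V + ∑ W ∈ S.erase V, e W * ψ W := by ring
    rw [this]
    apply Valuation.map_add_lt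
    · rw [map_mul]; exact mul_lt_one_of_lt_of_le (he1 V hV) (hψ V V hV)
    · apply Valuation.map_sum_lt _ one_ne_zero
      intro W hW
      rw [map_mul]
      exact mul_lt_one_of_lt_of_le (he2 W (Finset.mem_of_mem_erase hW) V hV
        (Finset.ne_of_mem_erase hW)) (hψ W V hV)
  have hle : V.valuation (∑ V ∈ S, e V * ψ V) ≤ 1 := by
    have := Valuation.map_add_le V.valuation hlt.le (hψ V V hV)
    simpa using this
  have h1 := val_poly_congr (hK V hV) hle (hψ V V hV) hlt p
  have h2 := hψg V hV p hp
  have h3 := Valuation.map_add_eq_of_lt_left V.valuation (h1.trans_eq h2.symm)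
  rw [add_sub_cancel] at h3
  rw [h3, h2]

theorem exists_common_good {ι : Type*} [Finite ι] (V : ι → ValuationSubring Ω) (φ : ι → Ω)
    (hφ : ∀ i, GoodAt K (V i) (φ i)) : ∃ ψ : Ω, ∀ i, GoodAt K (V i) ψ := by
  classical
  cases nonempty_fintype ι
  let T : Finset (ValuationSubring Ω) := Finset.univ.image V
  let S := T.filter (fun W => Minimal (· ∈ T) W)
  have : ∀ W : ValuationSubring Ω, ∃ φ : Ω, W ∈ T → GoodAt K W φ := by
    intro W
    by_cases h : W ∈ T
    · obtain ⟨i, _, rfl⟩ := Finset.mem_image.1 h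
      exact ⟨φ i, fun _ => hφ i⟩
    · exact ⟨0, fun h' => absurd h' h⟩
  choose φ' hφ' using this
  obtain ⟨ψ, hψ⟩ := exists_common_antichain (K := K) S (by
    intro V hV W hW hne hle
    have h2 := (Finset.mem_filter.1 hW).2
    exact hne (le_antisymm hle (h2.2 (Finset.mem_filter.1 hV).1 hle))) φ'
    (fun V hV => hφ' V (Finset.mem_filter.1 hV).1)
  refine ⟨ψ, fun i => ?_⟩
  obtain ⟨W, hWi, hW⟩ := T.exists_le_minimal (a := V i) (Finset.mem_image_of_mem _ (Finset.mem_univ i))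
  exact (hψ W (Finset.mem_filter.2 ⟨hW.1, hW⟩)).mono hWi

end ModA


section ModB

/-- number of Noether normalization parameters is the transcendence degree -/
lemma trdeg_of_normalization {K A Ω : Type u} [Field K] [Field Ω] [CommRing A] [IsDomain A]
    [Algebra K A] [Algebra A Ω] [Algebra K Ω] [IsScalarTower K A Ω] [FaithfulSMul A Ω]
    [Algebra.IsAlgebraic A Ω] {s : ℕ} (g : MvPolynomial (Fin s) K →ₐ[K] A)
    (hg : Function.Injective g) (hg' : g.IsIntegral) : Algebra.trdeg K Ω = s := by
  algebraize [g.toRingHom]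
  have : FaithfulSMul (MvPolynomial (Fin s) K) A := (faithfulSMul_iff_algebraMap_injective _ _).2 hg
  have : IsScalarTower K (MvPolynomial (Fin s) K) A :=
    IsScalarTower.of_algebraMap_eq fun x => by
      change _ = g _
      exact (g.commutes x).symm
  have : Algebra.IsIntegral (MvPolynomial (Fin s) K) A := ⟨hg'⟩
  have h0 : FaithfulSMul K A := FaithfulSMul.trans K (MvPolynomial (Fin s) K) A
  have h1 := _root_.trdeg_add_eq K A (A := Ω)
  have h2 := _root_.trdeg_add_eq K (MvPolynomial (Fin s) K) (A := A)
  rw [← h1, ← h2]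
  have h3 : Algebra.trdeg A Ω = 0 := _root_.trdeg_eq_zero
  have h4 : Algebra.trdeg (MvPolynomial (Fin s) K) A = 0 := _root_.trdeg_eq_zero
  simp [h3, h4]

lemma isIntegral_of_params {K A : Type*} [Field K] [CommRing A] [Algebra K A] {s : ℕ}
    (g : MvPolynomial (Fin s) K →ₐ[K] A) (hg' : g.IsIntegral) (p : Fin s → K[X])
    (hp : ∀ j, (p j).Monic) (hd : ∀ j, 0 < (p j).natDegree) :
    (MvPolynomial.aeval (R := K) fun j => aeval (g (.X j)) (p j)).IsIntegral := by
  set t : Fin s → A := fun j => aeval (g (.X j)) (p j) with ht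
  let h : (MvPolynomial (Fin s) K) →ₐ[K] A := MvPolynomial.aeval t
  let : Algebra (MvPolynomial (Fin s) K) A := h.toRingHom.toAlgebra
  have hsm : ∀ x : (MvPolynomial (Fin s) K), algebraMap (MvPolynomial (Fin s) K) A x = h x := fun _ => rfl
  let I : Subalgebra (MvPolynomial (Fin s) K) A := integralClosure (MvPolynomial (Fin s) K) A
  have hX : ∀ j, g (.X j) ∈ I := by
    intro j
    refine ⟨(p j).map (algebraMap K (MvPolynomial (Fin s) K)) - C (.X j), ?_, ?_⟩
    · apply ((hp j).map _).sub_of_left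
      rw [Polynomial.degree_map]
      calc _ ≤ (0 : WithBot ℕ) := degree_C_le
        _ < _ := by rw [degree_eq_natDegree (hp j).ne_zero]; exact_mod_cast hd j
    · rw [eval₂_sub, eval₂_C, eval₂_map]
      have : (algebraMap (MvPolynomial (Fin s) K) A).comp (algebraMap K (MvPolynomial (Fin s) K)) = algebraMap K A := by
        ext x
        simp only [RingHom.comp_apply, hsm]
        exact h.commutes x
      rw [this, hsm]
      simp [h, ht, aeval_def]
  have hI : ∀ f, g f ∈ I := by
    intro f
    induction f using MvPolynomial.induction_on with
    | C a =>
      have : g (.C a) = algebraMap (MvPolynomial (Fin s) K) A (.C a) := by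
        rw [hsm]
        exact (g.commutes a).trans (h.commutes a).symm
      rw [this]; exact I.algebraMap_mem _
    | add p q hp hq => rw [map_add]; exact I.add_mem hp hq
    | mul_X p j hp => rw [map_mul]; exact I.mul_mem hp (hX j)
  let g' : (MvPolynomial (Fin s) K) →+* I := g.toRingHom.codRestrict I hI
  intro x
  obtain ⟨q, hq, hq'⟩ := hg' x
  have : IsIntegral I x := by
    refine ⟨q.map g', hq.map _, ?_⟩
    rw [eval₂_map]; exact hq'
  exact isIntegral_trans (R := (MvPolynomial (Fin s) K)) (A := I) x this

lemma exists_params {K Ω : Type u} [Field K] [Field Ω] [Algebra K Ω] (A : Subalgebra K Ω)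
    (hA : A.FG) [Algebra.IsAlgebraic A Ω] (htr : 2 ≤ Algebra.trdeg K Ω) (m : Ideal A)
    [m.IsMaximal] : ∃ s : ℕ, 2 ≤ s ∧ ∃ t : Fin s → A, AlgebraicIndependent K t ∧
      (MvPolynomial.aeval (R := K) t).IsIntegral ∧ ∀ j, t j ∈ m := by
  have : Algebra.FiniteType K A := A.fg_iff_finiteType.1 hA
  obtain ⟨s, g, hg, hg'⟩ := exists_integral_inj_algHom_of_fg K A
  have hs := trdeg_of_normalization (Ω := Ω) g hg hg'
  refine ⟨s, by rw [hs] at htr; exact_mod_cast htr, ?_⟩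
  let : Field (A ⧸ m) := Ideal.Quotient.field m
  have hfin : Module.Finite K (A ⧸ m) := finite_of_finite_type_of_isJacobsonRing K (A ⧸ m)
  have hintegral : ∀ x : A ⧸ m, IsIntegral K x := fun x => IsIntegral.of_finite K x
  let p : Fin s → K[X] := fun j => minpoly K (Ideal.Quotient.mk m (g (.X j)))
  have hd : ∀ j, 0 < (p j).natDegree := fun j => minpoly.natDegree_pos (hintegral _)
  have hp : ∀ j, (p j).Monic := fun j => minpoly.monic (hintegral _)
  refine ⟨fun j => aeval (g (.X j)) (p j), ?_, isIntegral_of_params g hg' p hp hd, ?_⟩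
  · have : AlgebraicIndependent K fun j => g (.X j) := by
      have : MvPolynomial.aeval (R := K) (fun j => g (.X j)) = g := by
        ext j; simp
      rw [AlgebraicIndependent, this]; exact hg
    exact this.polynomial_aeval_of_transcendental fun i =>
      Polynomial.transcendental _ (hd i).ne' (by simp [(hp i).leadingCoeff])
  · intro j
    rw [← Ideal.Quotient.eq_zero_iff_mem]
    have := minpoly.aeval K (Ideal.Quotient.mk m (g (.X j)))
    rw [← this]
    exact (Polynomial.aeval_algHom_apply (Ideal.Quotient.mkₐ K m) (g (.X j)) (p j)).symm

/-- homogenization -/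
noncomputable def homog {A : Type*} [CommRing A] (t1 t2 : A) (g : A[X]) : A :=
  ∑ i ∈ Finset.range (g.natDegree + 1), g.coeff i * t1 ^ i * t2 ^ (g.natDegree - i)

lemma algebraMap_homog {A B : Type*} [CommRing A] [CommRing B] (f : A →+* B) (t1 t2 : A)
    (g : A[X]) (c : B) (hc : f t1 = c * f t2) :
    f (homog t1 t2 g) = f t2 ^ g.natDegree * eval₂ f c g := by
  rw [homog, map_sum, eval₂_eq_sum_range, Finset.mul_sum]
  apply Finset.sum_congr rfl
  intro i hi
  have hi' : i ≤ g.natDegree := Nat.lt_succ_iff.1 (Finset.mem_range.1 hi)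
  obtain ⟨k, hk⟩ := Nat.exists_eq_add_of_le hi'
  rw [hk, Nat.add_sub_cancel_left]
  simp only [map_mul, map_pow, hc, pow_add, mul_pow]
  ring

/-- the key nonvanishing -/
lemma key_disjoint {K A : Type u} {Ω : Type*} [Field K] [Field Ω] [CommRing A] [IsDomain A]
    [Algebra K A] (j : A →+* Ω) (hj : Function.Injective j) {s : ℕ} (i1 i2 : Fin s)
    (hi : i1 ≠ i2) (t : Fin s → A)
    (hti : AlgebraicIndependent K t) (htI : (MvPolynomial.aeval (R := K) t).IsIntegral)
    (m : Ideal A) [m.IsPrime] (htm : ∀ j, t j ∈ m) (p : K[X]) (hp : p ≠ 0) (f : A[X])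
    (hf : f ∈ m.map C)
    (h : eval₂ j (j (t i1) / j (t i2)) (p.map (algebraMap K A)) =
      eval₂ j (j (t i1) / j (t i2)) f) : False := by
  classical
  let E := AlgebraicClosure K
  obtain ⟨θ, hθ⟩ : ∃ θ : E, aeval θ p ≠ 0 := by
    by_contra! hcon
    have h0 : p.map (algebraMap K E) = 0 := by
      apply Polynomial.funext
      intro x
      rw [eval_map_algebraMap, hcon, eval_zero]
    exact hp ((Polynomial.map_eq_zero _).1 h0)
  let v : Fin s → E[X] := fun k => if k = i1 then C θ * X else if k = i2 then X else 0
  let γ : (MvPolynomial (Fin s) K) →ₐ[K] E[X] := MvPolynomial.aeval v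
  let 𝔤 : Ideal (MvPolynomial (Fin s) K) := RingHom.ker γ
  have h𝔤 : 𝔤.IsPrime := RingHom.ker_isPrime _
  have hγ1 : γ (.X i1) = C θ * X := by simp [γ, v]
  have hγ2 : γ (.X i2) = X := by simp [γ, v, hi.symm]
  let H : (MvPolynomial (Fin s) K) →ₐ[K] A := MvPolynomial.aeval t
  let : Algebra (MvPolynomial (Fin s) K) A := H.toRingHom.toAlgebra
  have hsm : ∀ x : (MvPolynomial (Fin s) K), algebraMap (MvPolynomial (Fin s) K) A x = H x := fun _ => rfl
  have : FaithfulSMul (MvPolynomial (Fin s) K) A := (faithfulSMul_iff_algebraMap_injective _ _).2 hti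
  have : Algebra.IsIntegral (MvPolynomial (Fin s) K) A := ⟨htI⟩
  have hle : 𝔤 ≤ m.under (MvPolynomial (Fin s) K) := by
    intro x hx
    rw [Ideal.under_def, Ideal.mem_comap, hsm]
    have hc : MvPolynomial.constantCoeff x = 0 := by
      have h1 : (Polynomial.evalRingHom (0 : E)) (γ x) = 0 := by
        rw [RingHom.mem_ker.1 hx, map_zero]
      have h2 : (Polynomial.evalRingHom (0 : E)) (γ x) =
          algebraMap K E (MvPolynomial.constantCoeff x) := by
        have : (Polynomial.evalRingHom (0 : E)).comp γ.toRingHom =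
            (algebraMap K E).comp MvPolynomial.constantCoeff := by
          apply MvPolynomial.ringHom_ext
          · intro r; simp [γ]
          · intro k
            simp only [AlgHom.toRingHom_eq_coe, RingHom.comp_apply, RingHom.coe_coe, γ,
              MvPolynomial.aeval_X, MvPolynomial.constantCoeff_X, map_zero, v]
            split_ifs <;> simp
        exact congrArg (fun F => F x) this
      rw [h2] at h1
      exact (map_eq_zero _).1 h1
    have h3 : (Ideal.Quotient.mk m).comp H.toRingHom =
        ((Ideal.Quotient.mk m).comp (algebraMap K A)).comp MvPolynomial.constantCoeff := by
      apply MvPolynomial.ringHom_ext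
      · intro r; simp [H]
      · intro k; simp [H, Ideal.Quotient.eq_zero_iff_mem, htm k]
    have h4 := congrArg (fun F => F x) h3
    simp only [RingHom.comp_apply, hc, map_zero] at h4
    exact Ideal.Quotient.eq_zero_iff_mem.1 h4
  obtain ⟨q, hqm, hq, hqo⟩ := Ideal.exists_ideal_le_liesOver_of_le (p := 𝔤) (q := m.under (MvPolynomial (Fin s) K)) m hle
  let L := q.ResidueField
  let F : A →+* L := algebraMap A L
  have hF : ∀ a, F a = 0 ↔ a ∈ q := fun a => Ideal.algebraMap_residueField_eq_zero
  have hqg : ∀ x : (MvPolynomial (Fin s) K), H x ∈ q ↔ x ∈ 𝔤 := by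
    intro x
    rw [hqo.over, Ideal.under_def, Ideal.mem_comap, hsm]
  have ht2 : F (t i2) ≠ 0 := by
    rw [Ne, hF]
    have : t i2 = H (.X i2) := by simp [H]
    rw [this, hqg, RingHom.mem_ker, hγ2]
    exact X_ne_zero
  have hjt2 : j (t i2) ≠ 0 := by
    rw [Ne, map_eq_zero_iff j hj]
    intro h0; rw [h0, map_zero] at ht2; exact ht2 rfl
  let c : L := F (t i1) / F (t i2)
  have hc : F (t i1) = c * F (t i2) := (div_mul_cancel₀ _ ht2).symm
  have htrans : eval₂ F c (p.map (algebraMap K A)) = eval₂ F c f := by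
    have h1 := algebraMap_homog j (t i1) (t i2) (p.map (algebraMap K A) - f)
      (j (t i1) / j (t i2)) (div_mul_cancel₀ _ hjt2).symm
    rw [eval₂_sub, h, sub_self, mul_zero, map_eq_zero_iff j hj] at h1
    have h2 := algebraMap_homog F (t i1) (t i2) (p.map (algebraMap K A) - f) c hc
    rw [h1, map_zero, eval₂_sub] at h2
    have h3 := (mul_eq_zero.1 h2.symm).resolve_left (pow_ne_zero _ ht2)
    exact sub_eq_zero.1 h3
  let FK : K →+* L := F.comp (algebraMap K A)
  let w := minpoly K θ
  have hθi : IsIntegral K θ := Algebra.IsIntegral.isIntegral θ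
  have hw : eval₂ FK c w = 0 := by
    have h1 := algebraMap_homog γ.toRingHom (.X i1) (.X i2) (w.map (algebraMap K (MvPolynomial (Fin s) K))) (C θ)
      (by simp [hγ1, hγ2])
    have h2 : eval₂ γ.toRingHom (C θ) (w.map (algebraMap K (MvPolynomial (Fin s) K))) = 0 := by
      rw [eval₂_map]
      have : γ.toRingHom.comp (algebraMap K (MvPolynomial (Fin s) K)) = (C : E →+* E[X]).comp (algebraMap K E) := by
        ext x; simp
      rw [this, ← Polynomial.hom_eval₂]
      have : eval₂ (algebraMap K E) θ w = 0 := minpoly.aeval K θ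
      rw [this, map_zero]
    rw [h2, mul_zero] at h1
    have h3 : (homog (.X i1) (.X i2) (w.map (algebraMap K (MvPolynomial (Fin s) K))) : (MvPolynomial (Fin s) K)) ∈ 𝔤 := h1
    rw [← hqg, ← hF] at h3
    have h4 := algebraMap_homog (F.comp H.toRingHom) (.X i1) (.X i2) (w.map (algebraMap K (MvPolynomial (Fin s) K))) c
      (by simpa [H] using hc)
    have h5 : (F.comp H.toRingHom) (homog (.X i1) (.X i2) (w.map (algebraMap K (MvPolynomial (Fin s) K)))) = 0 := h3
    rw [h5, eval₂_map] at h4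
    have h6 : (F.comp H.toRingHom).comp (algebraMap K (MvPolynomial (Fin s) K)) = FK := by
      ext x; simp [FK]
    rw [h6] at h4
    refine (mul_eq_zero.1 h4.symm).resolve_left (pow_ne_zero _ ?_)
    simpa [H] using ht2
  have hcop : IsCoprime p w := by
    rw [isCoprime_comm]
    rcases EuclideanDomain.dvd_or_coprime w p (minpoly.irreducible hθi) with h | h
    · exact absurd ((minpoly.dvd_iff).1 h) hθ
    · exact h
  obtain ⟨a, b, hab⟩ := hcop
  let B : Subalgebra A L := Algebra.adjoin A {c}
  have hcI : IsIntegral A c := by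
    refine ⟨w.map (algebraMap K A), (minpoly.monic hθi).map _, ?_⟩
    rw [eval₂_map]; exact hw
  have : Algebra.IsIntegral A B := Algebra.IsIntegral.adjoin (by simpa using hcI)
  obtain ⟨𝔫, -, h𝔫, h𝔫m⟩ := Ideal.exists_ideal_over_prime_of_isIntegral (S := B) m ⊥ (by
    intro x hx
    apply hqm
    rw [Ideal.mem_comap, Ideal.mem_bot] at hx
    rw [← hF]
    exact congrArg Subtype.val hx)
  let cB : B := ⟨c, Algebra.subset_adjoin (by simp)⟩
  have hsub : ∀ g : A[X], ((aeval cB g : B) : L) = eval₂ F c g := by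
    intro g
    rw [← aeval_def]
    exact (Polynomial.aeval_algHom_apply B.val cB g).symm
  have hsubK : ∀ g : K[X], ((aeval cB (g.map (algebraMap K A)) : B) : L) = eval₂ FK c g := by
    intro g
    rw [hsub, eval₂_map]
  have hfn : aeval cB f ∈ 𝔫 := by
    rw [aeval_eq_sum_range]
    apply Ideal.sum_mem
    intro i _
    rw [Algebra.smul_def]
    apply Ideal.mul_mem_right
    rw [← Ideal.mem_comap, h𝔫m]
    exact Ideal.mem_map_C_iff.1 hf i
  have hpn : aeval cB (p.map (algebraMap K A)) ∈ 𝔫 := by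
    have : aeval cB (p.map (algebraMap K A)) = aeval cB f := by
      apply Subtype.ext
      rw [hsub, hsub, htrans]
    rwa [this]
  apply h𝔫.ne_top
  rw [Ideal.eq_top_iff_one]
  have : (1 : B) = aeval cB (a.map (algebraMap K A)) * aeval cB (p.map (algebraMap K A)) := by
    apply Subtype.ext
    have h1 := congrArg (eval₂ FK c) hab
    rw [eval₂_add, eval₂_mul, eval₂_mul, hw, mul_zero, add_zero, eval₂_one] at h1
    change (1 : L) = (aeval cB (a.map (algebraMap K A)) : B).1 *
      (aeval cB (p.map (algebraMap K A)) : B).1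
    rw [hsubK, hsubK, h1]
  rw [this]
  exact Ideal.mul_mem_left _ _ hpn

theorem exists_good_val {K Ω : Type u} [Field K] [Field Ω] [Algebra K Ω] (A : Subalgebra K Ω)
    (hA : A.FG) [Algebra.IsAlgebraic A Ω] (htr : 2 ≤ Algebra.trdeg K Ω) (m : Ideal A)
    [m.IsMaximal] : ∃ (V : ValuationSubring Ω) (φ : Ω), GoodAt K V φ ∧
      (∀ a : A, V.valuation (a : Ω) ≤ 1) ∧ ∀ a ∈ m, V.valuation (a : Ω) < 1 := by
  obtain ⟨s, hs, t, hti, htI, htm⟩ := exists_params A hA htr m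
  let j : A →+* Ω := algebraMap A Ω
  let i1 : Fin s := ⟨0, by omega⟩
  let i2 : Fin s := ⟨1, by omega⟩
  have hi : i1 ≠ i2 := by simp [i1, i2]
  let φ : Ω := j (t i1) / j (t i2)
  let e : A[X] →+* Ω := eval₂RingHom j φ
  let J : Ideal A[X] := RingHom.ker e ⊔ m.map C
  let M : Submonoid A[X] := (nonZeroDivisors K[X]).map (mapRingHom (algebraMap K A))
  have hdis : Disjoint (J : Set A[X]) M := by
    rw [Set.disjoint_left]
    rintro _ hJ ⟨p, hp, rfl⟩
    obtain ⟨k, hk, f, hf, hkf⟩ := Submodule.mem_sup.1 hJ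
    refine key_disjoint j Subtype.val_injective i1 i2 hi t hti htI m htm p
      (nonZeroDivisors.ne_zero hp) f hf ?_
    have h1 := congrArg e hkf
    rw [map_add, RingHom.mem_ker.1 hk, zero_add] at h1
    exact h1.symm
  obtain ⟨𝔓, h𝔓, hJ𝔓, hM⟩ := Ideal.exists_le_prime_disjoint J M hdis
  have hker : RingHom.ker e.rangeRestrict ≤ 𝔓 := by
    rw [RingHom.ker_rangeRestrict]
    exact le_sup_left.trans hJ𝔓
  let Q : Ideal e.range := 𝔓.map e.rangeRestrict
  have hQ : Q.IsPrime := Ideal.map_isPrime_of_surjective e.rangeRestrict_surjective hker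
  have hQmem : ∀ x, e.rangeRestrict x ∈ Q ↔ x ∈ 𝔓 := by
    intro x
    constructor
    · intro hx
      obtain ⟨y, hy, hxy⟩ := (Ideal.mem_map_iff_of_surjective _ e.rangeRestrict_surjective).1 hx
      have : x - y ∈ RingHom.ker e.rangeRestrict := by
        rw [RingHom.mem_ker, map_sub, hxy, sub_self]
      have := 𝔓.add_mem (hker this) hy
      simpa using this
    · exact fun hx => Ideal.mem_map_of_mem _ hx
  obtain ⟨V, hV, hloc⟩ := (LocalSubring.ofPrime e.range Q).exists_le_valuationSubring
  have hle : ∀ x : A[X], V.valuation (e x) ≤ 1 := by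
    intro x
    rw [ValuationSubring.valuation_le_one_iff]
    exact hV (LocalSubring.le_ofPrime _ _ (e.rangeRestrict x).2)
  have hone : ∀ x : A[X], V.valuation (e x) = 1 ↔ x ∉ 𝔓 := by
    intro x
    have h1 : IsUnit (algebraMap e.range (LocalSubring.ofPrime e.range Q).toSubring
        (e.rangeRestrict x)) ↔ x ∉ 𝔓 := by
      rw [IsLocalization.AtPrime.isUnit_to_map_iff _ Q, Ideal.mem_primeCompl_iff, hQmem]
    rw [← h1]
    have h2 : (⟨e x, (V.valuation_le_one_iff _).1 (hle x)⟩ : V) =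
      Subring.inclusion hV (algebraMap e.range (LocalSubring.ofPrime e.range Q).toSubring
        (e.rangeRestrict x)) := rfl
    have h3 := V.valuation_eq_one_iff ⟨e x, (V.valuation_le_one_iff _).1 (hle x)⟩
    rw [← h3]
    constructor
    · intro h
      rw [h2] at h
      exact hloc.map_nonunit _ h
    · intro h
      rw [h2]
      exact h.map (Subring.inclusion hV)
  refine ⟨V, φ, ?_, ?_, ?_⟩
  · intro p hp
    have h1 : aeval φ p = e (p.map (algebraMap K A)) := by
      simp only [e, coe_eval₂RingHom, eval₂_map]
      rfl
    rw [h1, hone]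
    intro hmem
    exact Set.disjoint_left.1 hM hmem ⟨p, mem_nonZeroDivisors_of_ne_zero hp, rfl⟩
  · intro a
    have h2 := hle (C a)
    have h1 : e (C a) = a := eval₂_C _ _
    rwa [h1] at h2
  · intro a ha
    have h1 : e (C a) = a := eval₂_C _ _
    have h2 := hle (C a)
    have h3 := hone (C a)
    rw [h1] at h2 h3
    refine lt_of_le_of_ne h2 fun h => ?_
    exact h3.1 h (hJ𝔓 (le_sup_right (a := RingHom.ker e) (Ideal.mem_map_of_mem C ha)))
end ModB

section ModN
theorem exists_algHom_of_fg (L0 S Λ : Type u) [CommRing L0] [IsDomain L0] [CommRing S] [Algebra L0 S]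
    [Algebra.FiniteType L0 S] (hinj : Function.Injective (algebraMap L0 S)) [Field Λ] [IsAlgClosed Λ]
    [Algebra L0 Λ] (hΛ : Function.Injective (algebraMap L0 Λ)) : Nonempty (S →ₐ[L0] Λ) := by
  let F := FractionRing L0
  let T := Localization (Algebra.algebraMapSubmonoid S (nonZeroDivisors L0))
  have hnt : Nontrivial T := by
    apply OreLocalization.nontrivial_iff.mpr
    rintro ⟨a, ha, h0⟩
    have : a = 0 := hinj (by rw [h0, map_zero])
    exact nonZeroDivisors.ne_zero ha this
  let : Algebra F T := localizationAlgebra (nonZeroDivisors L0) S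
  have : IsScalarTower L0 F T := IsScalarTower.of_algebraMap_eq' (by
    exact (IsLocalization.map_comp _).symm)
  have hft : Algebra.FiniteType F T := by
    have h1 : (algebraMap L0 S).FiniteType := RingHom.finiteType_algebraMap.mpr inferInstance
    have : IsLocalization (Submonoid.map (algebraMap L0 S) (nonZeroDivisors L0)) T :=
      inferInstanceAs (IsLocalization (Algebra.algebraMapSubmonoid S (nonZeroDivisors L0)) T)
    have h2 := RingHom.finiteType_localizationPreserves (algebraMap L0 S) (nonZeroDivisors L0) F T h1
    exact h2
  obtain ⟨M, hM⟩ := Ideal.exists_maximal T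
  let : Field (T ⧸ M) := Ideal.Quotient.field M
  have : Algebra.FiniteType F (T ⧸ M) :=
    Algebra.FiniteType.of_surjective (Ideal.Quotient.mkₐ F M) (Ideal.Quotient.mkₐ_surjective F M)
  have : Module.Finite F (T ⧸ M) := finite_of_finite_type_of_isJacobsonRing F (T ⧸ M)
  let : Algebra F Λ := (IsFractionRing.lift (A := L0) (K := F) (L := Λ) hΛ).toAlgebra
  have : IsScalarTower L0 F Λ := IsScalarTower.of_algebraMap_eq (fun r => by
    exact (IsFractionRing.lift_algebraMap hΛ r).symm)
  have : Module.IsTorsionFree F (T ⧸ M) := Module.isTorsionFree_iff_algebraMap_injective.mpr (algebraMap F (T ⧸ M)).injective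
  let g : (T ⧸ M) →ₐ[F] Λ := IsAlgClosed.lift
  exact ⟨(g.restrictScalars L0).comp (((Ideal.Quotient.mkₐ F M).restrictScalars L0).comp
    (IsScalarTower.toAlgHom L0 S T))⟩

/-- The monic polynomial of degree `d` with prescribed lower coefficients. -/
noncomputable def mkPoly {σ R : Type*} [CommRing R] (T : Finset (σ →₀ ℕ)) (d : ℕ)
    (c : ℕ → (σ →₀ ℕ) → R) : (MvPolynomial σ R)[X] :=
  X ^ d + ∑ j : Fin d, C (∑ t ∈ T, MvPolynomial.monomial t (c j t)) * X ^ (j : ℕ)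

theorem mkPoly_monic {σ R : Type*} [CommRing R] (T : Finset (σ →₀ ℕ)) (d : ℕ)
    (c : ℕ → (σ →₀ ℕ) → R) : (mkPoly T d c).Monic :=
  monic_X_pow_add (degree_sum_fin_lt _)

theorem mkPoly_natDegree {σ R : Type*} [CommRing R] [Nontrivial R] (T : Finset (σ →₀ ℕ)) (d : ℕ)
    (c : ℕ → (σ →₀ ℕ) → R) : (mkPoly T d c).natDegree = d := by
  apply natDegree_eq_of_degree_eq_some
  unfold mkPoly
  rw [degree_add_eq_left_of_degree_lt, degree_X_pow]
  rw [degree_X_pow]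
  exact (degree_sum_fin_lt _)

theorem mkPoly_map {σ R S : Type*} [CommRing R] [CommRing S] (h : R →+* S)
    (T : Finset (σ →₀ ℕ)) (d : ℕ)
    (c : ℕ → (σ →₀ ℕ) → R) : (mkPoly T d c).map (MvPolynomial.map h) =
      mkPoly T d (fun j t => h (c j t)) := by
  simp [mkPoly, Polynomial.map_sum, MvPolynomial.map_monomial]

theorem mkPoly_congr {σ R : Type*} [CommRing R] (T : Finset (σ →₀ ℕ)) (d : ℕ)
    (c c' : ℕ → (σ →₀ ℕ) → R) (h : ∀ a < d, ∀ t ∈ T, c a t = c' a t) :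
    mkPoly T d c = mkPoly T d c' := by
  unfold mkPoly
  congr 1
  refine Finset.sum_congr rfl fun j _ => ?_
  congr 2
  exact Finset.sum_congr rfl fun t ht => by rw [h j j.2 t ht]

theorem mkPoly_eq {σ R : Type*} [CommRing R] (T : Finset (σ →₀ ℕ)) 
    (p : (MvPolynomial σ R)[X]) (hp : p.Monic) (hT : ∀ j, (p.coeff j).support ⊆ T) :
    p = mkPoly T p.natDegree (fun j t => (p.coeff j).coeff t) := by
  classical
  have h := hp.as_sum
  unfold mkPoly
  conv_lhs => rw [h]
  congr 1
  rw [← Fin.sum_univ_eq_sum_range (fun i => C (p.coeff i) * X ^ i)]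
  refine Finset.sum_congr rfl fun j _ => ?_
  congr 2
  conv_lhs => rw [MvPolynomial.as_sum (p.coeff j)]
  refine Finset.sum_subset (hT j) fun t _ ht => ?_
  rw [MvPolynomial.notMem_support_iff.mp ht, map_zero]

theorem totalDegree_coeff_le_of_mul {σ k : Type*} [Field k] (p q : (MvPolynomial σ k)[X]) (h : p * q ≠ 0)
    (j : ℕ) : (p.coeff j).totalDegree ≤ ((MvPolynomial.optionEquivLeft k σ).symm (p * q)).totalDegree := by
  have h1 := MvPolynomial.totalDegree_coeff_optionEquivLeft_le k σ
    ((MvPolynomial.optionEquivLeft k σ).symm p) j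
  rw [AlgEquiv.apply_symm_apply] at h1
  refine h1.trans (MvPolynomial.totalDegree_le_of_dvd_of_isDomain ?_ ?_)
  · rw [map_mul]; exact dvd_mul_right _ _
  · simpa using h

theorem totalDegree_option_map_le {σ R k : Type*} [CommRing R] [CommRing k] (h : R →+* k)
    (p : (MvPolynomial σ R)[X]) :
    ((MvPolynomial.optionEquivLeft k σ).symm (p.map (MvPolynomial.map h))).totalDegree ≤
    ((MvPolynomial.optionEquivLeft R σ).symm p).totalDegree := by
  have : (MvPolynomial.optionEquivLeft k σ).symm (p.map (MvPolynomial.map h)) =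
    MvPolynomial.map h ((MvPolynomial.optionEquivLeft R σ).symm p) := by
    rw [AlgEquiv.symm_apply_eq]
    obtain ⟨r, rfl⟩ := (MvPolynomial.optionEquivLeft R σ).surjective p
    rw [AlgEquiv.symm_apply_apply]
    ext i m
    rw [Polynomial.coeff_map, MvPolynomial.coeff_map, MvPolynomial.optionEquivLeft_coeff_coeff,
      MvPolynomial.optionEquivLeft_coeff_coeff, MvPolynomial.coeff_map]
  rw [this]
  exact Finset.sup_mono (MvPolynomial.support_map_subset _ _)

theorem spread (L0 Λ I : Type u) [CommRing L0] [IsDomain L0] [Field Λ] [IsAlgClosed Λ] [Algebra L0 Λ]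
    (hΛ : Function.Injective (algebraMap L0 Λ)) [Infinite I] (k : I → Type u) [∀ i, Field (k i)]
    (h : ∀ i, L0 →+* k i) (hfin : ∀ a : L0, a ≠ 0 → {i | h i a = 0}.Finite)
    {σ : Type u} [Finite σ] (G : (MvPolynomial σ L0)[X]) (hG : G.Monic) (hd : G.natDegree ≠ 0)
    (hred : ∀ i, ¬ Irreducible (G.map (MvPolynomial.map (h i)))) :
    ∃ G1 G2 : (MvPolynomial σ Λ)[X], G1.Monic ∧ G2.Monic ∧
      G1 * G2 = G.map (MvPolynomial.map (algebraMap L0 Λ)) ∧ G1.natDegree < G.natDegree ∧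
      G2.natDegree < G.natDegree := by
  classical
  have key : ∀ i, ∃ d : Fin (G.natDegree), d.1 ≠ 0 ∧ ∃ p q : (MvPolynomial σ (k i))[X],
      p.Monic ∧ q.Monic ∧
      p * q = G.map (MvPolynomial.map (h i)) ∧ p.natDegree = d ∧
      q.natDegree = G.natDegree - d := by
    intro i
    have hm := hG.map (MvPolynomial.map (h i) : MvPolynomial σ L0 →+* _)
    have hnd : (G.map (MvPolynomial.map (h i))).natDegree = G.natDegree := hG.natDegree_map _
    have := hred i
    rw [hm.irreducible_iff_natDegree'] at this
    push Not at this
    obtain ⟨q, p, hq, hp, hpq, hdeg⟩ := this (by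
      intro h1
      rw [h1, natDegree_one] at hnd
      exact hd hnd.symm)
    rw [hnd, Finset.mem_Ioc] at hdeg
    have hadd : q.natDegree + p.natDegree = G.natDegree := by
      rw [← hnd, ← hpq, hq.natDegree_mul hp]
    refine ⟨⟨p.natDegree, by omega⟩, by simp; omega, p, q, hp, hq, by rw [mul_comm, hpq], rfl, ?_⟩
    simp; omega
  choose d hd0 p q hp hq hpq hpd hqd using key
  obtain ⟨d0, hinf⟩ := Finite.exists_infinite_fiber d
  let J := {i // d i = d0}
  have hJ : Infinite J := hinf
  let n := ((MvPolynomial.optionEquivLeft L0 σ).symm G).totalDegree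
  let T : Finset (σ →₀ ℕ) := (Finsupp.finite_of_degree_le (σ := σ) n).toFinset
  have hT : ∀ (i : I) (r : MvPolynomial σ (k i)), r.totalDegree ≤ n → r.support ⊆ T := by
    intro i r hr t ht
    rw [Set.Finite.mem_toFinset, Set.mem_ofPred_eq]
    refine le_trans ?_ hr
    exact MvPolynomial.le_totalDegree ht
  have hG0 : ∀ i, G.map (MvPolynomial.map (h i) : MvPolynomial σ L0 →+* _) ≠ 0 := fun i =>
    (hG.map (MvPolynomial.map (h i) : MvPolynomial σ L0 →+* _)).ne_zero
  have hpT : ∀ i j, ((p i).coeff j).support ⊆ T := fun i j => hT i _ (by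
    refine (totalDegree_coeff_le_of_mul (p i) (q i) (by rw [hpq]; exact hG0 i) j).trans ?_
    rw [hpq]; exact totalDegree_option_map_le _ _)
  have hqT : ∀ i j, ((q i).coeff j).support ⊆ T := fun i j => hT i _ (by
    refine (totalDegree_coeff_le_of_mul (q i) (p i) (by rw [mul_comm, hpq]; exact hG0 i) j).trans ?_
    rw [mul_comm, hpq]; exact totalDegree_option_map_le _ _)
  let Pr := ∀ j : J, k j.1
  let : Algebra L0 Pr := (RingHom.pi (fun j : J => h j.1)).toAlgebra
  let cp : ℕ → (σ →₀ ℕ) → Pr := fun a t j => ((p j.1).coeff a).coeff t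
  let cq : ℕ → (σ →₀ ℕ) → Pr := fun a t j => ((q j.1).coeff a).coeff t
  let W : Finset Pr := ((Finset.range G.natDegree) ×ˢ T).image (fun x => cp x.1 x.2) ∪
    ((Finset.range G.natDegree) ×ˢ T).image (fun x => cq x.1 x.2)
  let S := Algebra.adjoin L0 (W : Set Pr)
  have hSft : Algebra.FiniteType L0 S :=
    (Subalgebra.fg_iff_finiteType _).mp (Subalgebra.fg_adjoin_finset W)
  let cp' : ℕ → (σ →₀ ℕ) → S := fun a t => if hh : cp a t ∈ S then ⟨_, hh⟩ else 0
  let cq' : ℕ → (σ →₀ ℕ) → S := fun a t => if hh : cq a t ∈ S then ⟨_, hh⟩ else 0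
  have hcp : ∀ a < G.natDegree, ∀ t ∈ T, cp a t ∈ S := fun a ha t ht => Algebra.subset_adjoin (by
    refine Finset.mem_coe.mpr (Finset.mem_union_left _ (Finset.mem_image.mpr ⟨(a, t), ?_, rfl⟩))
    exact Finset.mem_product.mpr ⟨Finset.mem_range.mpr ha, ht⟩)
  have hcq : ∀ a < G.natDegree, ∀ t ∈ T, cq a t ∈ S := fun a ha t ht => Algebra.subset_adjoin (by
    refine Finset.mem_coe.mpr (Finset.mem_union_right _ (Finset.mem_image.mpr ⟨(a, t), ?_, rfl⟩))
    exact Finset.mem_product.mpr ⟨Finset.mem_range.mpr ha, ht⟩)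
  have hd0 : d0.1 ≠ 0 := by
    obtain ⟨j⟩ : Nonempty J := inferInstance
    have := hd0 j.1
    rwa [j.2] at this
  have hd0' : d0.1 < G.natDegree := d0.2
  let ρ : ∀ j : J, S →+* k j.1 := fun j => (Pi.evalRingHom (fun j : J => k j.1) j).comp S.val.toRingHom
  have hEq : mkPoly T d0.1 cp' * mkPoly T (G.natDegree - d0.1) cq' =
      G.map (MvPolynomial.map (algebraMap L0 S)) := by
    have hρ : ∀ j : J, (mkPoly T d0.1 cp' * mkPoly T (G.natDegree - d0.1) cq').map
        (MvPolynomial.map (ρ j)) =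
        (G.map (MvPolynomial.map (algebraMap L0 S))).map (MvPolynomial.map (ρ j)) := by
      intro j
      have e1 : (mkPoly T d0.1 cp').map (MvPolynomial.map (ρ j)) = p j.1 := by
        rw [mkPoly_map, mkPoly_eq T (p j.1) (hp _) (hpT _), hpd, j.2]
        refine mkPoly_congr _ _ _ _ fun a ha t ht => ?_
        have : cp' a t = ⟨cp a t, hcp a (by omega) t ht⟩ := dif_pos _
        rw [this]
        rfl
      have e2 : (mkPoly T (G.natDegree - d0.1) cq').map (MvPolynomial.map (ρ j)) = q j.1 := by
        rw [mkPoly_map, mkPoly_eq T (q j.1) (hq _) (hqT _), hqd, j.2]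
        refine mkPoly_congr _ _ _ _ fun a ha t ht => ?_
        have : cq' a t = ⟨cq a t, hcq a (by omega) t ht⟩ := dif_pos _
        rw [this]
        rfl
      rw [Polynomial.map_mul, e1, e2, hpq, Polynomial.map_map]
      congr 1
      refine MvPolynomial.ringHom_ext (fun x => ?_) (fun x => ?_)
      · simp only [MvPolynomial.map_C, RingHom.comp_apply]
        rfl
      · simp
    ext a t j
    rw [Polynomial.coeff_map, MvPolynomial.coeff_map]
    have := congrArg (fun r => (r.coeff a).coeff t) (hρ j)
    simp only [Polynomial.coeff_map, MvPolynomial.coeff_map] at this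
    exact this
  have hSinj : Function.Injective (algebraMap L0 S) := by
    rw [injective_iff_map_eq_zero]
    intro a ha
    by_contra hne
    have hfi := hfin a hne
    have : ∀ j : J, h j.1 a = 0 := fun j => congrFun (congrArg Subtype.val ha) j
    have hsub : (Set.range (Subtype.val : J → I)) ⊆ {i | h i a = 0} := by
      rintro _ ⟨j, rfl⟩
      exact this j
    exact Set.infinite_range_of_injective Subtype.val_injective (hfi.subset hsub)
  obtain ⟨θ⟩ := exists_algHom_of_fg L0 S Λ hSinj hΛ
  refine ⟨(mkPoly T d0.1 cp').map (MvPolynomial.map θ.toRingHom),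
    (mkPoly T (G.natDegree - d0.1) cq').map (MvPolynomial.map θ.toRingHom),
    (mkPoly_monic _ _ _).map _, (mkPoly_monic _ _ _).map _, ?_, ?_, ?_⟩
  · rw [← Polynomial.map_mul, hEq, Polynomial.map_map]
    congr 1
    refine MvPolynomial.ringHom_ext (fun x => ?_) (fun x => ?_)
    · simp only [MvPolynomial.map_C, RingHom.comp_apply]
      congr 1
      exact θ.commutes x
    · simp
  · rw [mkPoly_map, mkPoly_natDegree]; exact hd0'
  · rw [mkPoly_map, mkPoly_natDegree]; omega
end ModN

section ModD1
theorem exists_prime_of_ev {B D Ω : Type*} [CommRing B] [CommRing D] [CommRing Ω]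
    (j : D →+* Ω) (ev : B →+* Ω) (𝔮 : Ideal B) [h𝔮 : 𝔮.IsPrime] (hker : ∀ b, ev b = 0 → b ∈ 𝔮)
    (S0 : B) (hS0 : S0 ∉ 𝔮) (q : ℕ) (hq : q ≠ 0) (hadd : ∀ x y : Ω, (x + y) ^ q = x ^ q + y ^ q)
    (hD : ∀ d : D, ∃ (N : ℕ) (F : B), ev S0 ^ N * j d ^ q = ev F) :
    ∃ Q : Ideal D, Q.IsPrime ∧
      ∀ x, x ∈ Q ↔ ∃ (N : ℕ) (F : B), F ∈ 𝔮 ∧ ev S0 ^ N * j x ^ q = ev F := by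
  have hsub : ∀ a b, ev a = ev b → a ∈ 𝔮 → b ∈ 𝔮 := by
    intro a b hab ha
    have := hker (b - a) (by rw [map_sub, hab, sub_self])
    simpa using 𝔮.add_mem this ha
  let Q : Ideal D :=
    { carrier := {x | ∃ (N : ℕ) (F : B), F ∈ 𝔮 ∧ ev S0 ^ N * j x ^ q = ev F}
      zero_mem' := ⟨0, 0, 𝔮.zero_mem, by simp [hq]⟩
      add_mem' := by
        rintro x y ⟨N, F, hF, h⟩ ⟨N', F', hF', h'⟩
        refine ⟨N + N', S0 ^ N' * F + S0 ^ N * F', 𝔮.add_mem (𝔮.mul_mem_left _ hF)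
          (𝔮.mul_mem_left _ hF'), ?_⟩
        rw [map_add, hadd, map_add, map_mul, map_mul, ← h, ← h', map_pow, map_pow]
        ring
      smul_mem' := by
        rintro c x ⟨N, F, hF, h⟩
        obtain ⟨N', F', h'⟩ := hD c
        refine ⟨N + N', F' * F, 𝔮.mul_mem_left _ hF, ?_⟩
        rw [smul_eq_mul, map_mul, map_mul, ← h, ← h']
        ring }
  have hQ : ∀ x, x ∈ Q ↔ ∃ (N : ℕ) (F : B), F ∈ 𝔮 ∧ ev S0 ^ N * j x ^ q = ev F := fun x => Iff.rfl
  refine ⟨Q, ⟨?_, ?_⟩, hQ⟩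
  · rw [Ideal.ne_top_iff_one, hQ]
    rintro ⟨N, F, hF, h⟩
    rw [map_one, one_pow, mul_one, ← map_pow] at h
    exact hS0 (h𝔮.mem_of_pow_mem N (hsub _ _ h.symm hF))
  · intro x y hxy
    rw [hQ] at hxy
    obtain ⟨M, H, hH, h⟩ := hxy
    obtain ⟨N, F, hF⟩ := hD x
    obtain ⟨N', F', hF'⟩ := hD y
    have h1 : ev (S0 ^ (N + N') * H) = ev (S0 ^ M * (F * F')) := by
      rw [map_mul, map_mul, map_mul, ← h, ← hF, ← hF', map_pow, map_pow, map_mul]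
      ring
    have h2 := hsub _ _ h1 (𝔮.mul_mem_left _ hH)
    rcases h𝔮.mem_or_mem h2 with h3 | h3
    · exact absurd (h𝔮.mem_of_pow_mem M h3) hS0
    · rcases h𝔮.mem_or_mem h3 with h4 | h4
      · exact Or.inl ⟨N, F, h4, hF⟩
      · exact Or.inr ⟨N', F', h4, hF'⟩
end ModD1

section ModD2

/-- Evaluation at `(y, z)`. -/
noncomputable def evRH (R : Type*) {Ω σ : Type*} [CommRing R] [CommRing Ω] [Algebra R Ω] (y : σ → Ω) (z : Ω) :
    (MvPolynomial σ R)[X] →+* Ω :=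
  eval₂RingHom (MvPolynomial.aeval y : MvPolynomial σ R →ₐ[R] Ω).toRingHom z

section
variable {R Ω σ : Type*} [CommRing R] [CommRing Ω] [Algebra R Ω] (y : σ → Ω) (z : Ω)

@[simp] theorem evRH_C (v : MvPolynomial σ R) : evRH R y z (C v) = MvPolynomial.aeval y v := by
  simp [evRH]

@[simp] theorem evRH_X : evRH R y z X = z := by
  simp [evRH]

theorem evRH_eq (F : (MvPolynomial σ R)[X]) : evRH R y z F =
    F.eval₂ (MvPolynomial.aeval y : MvPolynomial σ R →ₐ[R] Ω).toRingHom z := rfl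

theorem evRH_map {R' : Type*} [CommRing R'] [Algebra R R'] [Algebra R' Ω] [IsScalarTower R R' Ω]
    (F : (MvPolynomial σ R)[X]) :
    evRH R' y z (F.map (MvPolynomial.map (algebraMap R R'))) = evRH R y z F := by
  rw [evRH_eq, evRH_eq, Polynomial.eval₂_map]
  congr 1
  refine MvPolynomial.ringHom_ext (fun x => ?_) (fun x => ?_)
  · simp [← IsScalarTower.algebraMap_apply]
  · simp
end

theorem field_model {Λ Ω : Type u} [Field Λ] [Field Ω] [Algebra Λ Ω] (Gen : Set Ω) (hfin : Gen.Finite)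
    [halg : Algebra.IsAlgebraic (Algebra.adjoin Λ Gen) Ω] :
    ∃ (σ : Type u) (_ : Finite σ) (y : σ → Ω) (z : Ω) (G : (MvPolynomial σ Λ)[X]) (q : ℕ),
      (∀ i, y i ∈ Gen) ∧ AlgebraicIndependent Λ y ∧ z ∈ IntermediateField.adjoin Λ Gen ∧ G.Monic ∧
      evRH Λ y z G = 0 ∧ (∀ F, F ≠ 0 → evRH Λ y z F = 0 → G.natDegree ≤ F.natDegree) ∧
      q ≠ 0 ∧ (∀ a b : Ω, (a + b) ^ q = a ^ q + b ^ q) ∧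
      ∀ a ∈ Gen, ∃ v : MvPolynomial σ Λ, v ≠ 0 ∧ ∃ F, MvPolynomial.aeval y v * a ^ q = evRH Λ y z F := by
  classical
  obtain ⟨Y, -, hYG, hY⟩ := exists_isTranscendenceBasis_between (R := Λ) (A := Ω) ∅ Gen
    (Set.empty_subset _) (by
      have := (algebraicIndependent_empty_iff Λ Ω).mpr (algebraMap Λ Ω).injective
      exact this)
  have hYfin : Finite Y := hfin.subset hYG
  let y : Y → Ω := Subtype.val
  have hyind : AlgebraicIndependent Λ y := hY.1
  have hyinj : Function.Injective (MvPolynomial.aeval y : MvPolynomial Y Λ →ₐ[Λ] Ω) := hyind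
  let E := IntermediateField.adjoin Λ (Set.range y)
  have hE : Algebra.IsAlgebraic E Ω := hY.isAlgebraic_field
  let p := ringExpChar Ω
  have : ExpChar Ω p := ringExpChar.expChar Ω
  have : ExpChar E p := (algebraMap E Ω).expChar (algebraMap E Ω).injective p
  have : ExpChar (separableClosure E Ω) p := (algebraMap (separableClosure E Ω) Ω).expChar
    (algebraMap (separableClosure E Ω) Ω).injective p
  have hpow : ∀ a : Ω, ∃ n : ℕ, a ^ p ^ n ∈ separableClosure E Ω := by
    intro a
    obtain ⟨n, b, hb⟩ := IsPurelyInseparable.pow_mem (separableClosure E Ω) p a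
    exact ⟨n, by rw [← hb]; exact b.2⟩
  choose nn hnn using hpow
  let n := ∑ a ∈ hfin.toFinset, nn a
  have hn : ∀ a ∈ Gen, a ^ p ^ n ∈ separableClosure E Ω := by
    intro a ha
    have hle : nn a ≤ n := Finset.single_le_sum (f := nn) (fun _ _ => Nat.zero_le _)
      (hfin.mem_toFinset.mpr ha)
    obtain ⟨k, hk⟩ := Nat.exists_eq_add_of_le hle
    rw [hk, pow_add, pow_mul]
    exact pow_mem (hnn a) _
  let W : Set Ω := (fun a => a ^ p ^ n) '' Gen
  have hW : Finite W := hfin.image _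
  let M := IntermediateField.adjoin E W
  have hsep : Algebra.IsSeparable E M := by
    rw [IntermediateField.isSeparable_adjoin_iff_isSeparable]
    rintro _ ⟨a, ha, rfl⟩
    exact mem_separableClosure_iff.mp (hn a ha)
  have hfd : FiniteDimensional E M := IntermediateField.finiteDimensional_adjoin
    fun x _ => (hE.isAlgebraic x).isIntegral
  obtain ⟨α, hα⟩ := Field.exists_primitive_element E M
  let z0 : Ω := α
  have hz0 : IntermediateField.adjoin E {z0} = M := by
    have := congrArg (IntermediateField.lift (F := M)) hα
    rw [IntermediateField.lift_adjoin_simple, IntermediateField.lift_top] at this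
    exact this
  have hfrac : ∀ e ∈ E, ∃ v : MvPolynomial Y Λ, v ≠ 0 ∧ ∃ w : MvPolynomial Y Λ,
      MvPolynomial.aeval y v * e = MvPolynomial.aeval y w := by
    intro e he
    rw [IntermediateField.mem_adjoin_iff_div] at he
    obtain ⟨r, hr, s, hs, rfl⟩ := he
    rw [Algebra.adjoin_range_eq_range_aeval] at hr hs
    obtain ⟨w, rfl⟩ := hr
    obtain ⟨v, rfl⟩ := hs
    by_cases h0 : v = 0
    · exact ⟨1, one_ne_zero, 0, by simp [h0]⟩
    · refine ⟨v, h0, w, mul_div_cancel₀ _ ?_⟩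
      exact (map_ne_zero_iff _ hyinj).mpr h0
  have hex0 : ∃ F : (MvPolynomial Y Λ)[X], F ≠ 0 ∧ evRH Λ y z0 F = 0 := by
    have := hY.isAlgebraic.isAlgebraic z0
    obtain ⟨P, hP0, hP⟩ := this
    refine ⟨P.map hyind.aevalEquiv.symm.toRingEquiv.toRingHom, ?_, ?_⟩
    · rwa [Ne, Polynomial.map_eq_zero_iff]
      exact hyind.aevalEquiv.symm.injective
    · rw [evRH_eq, Polynomial.eval₂_map]
      rw [Polynomial.aeval_def] at hP
      rw [← hP]
      congr 1
      refine RingHom.ext fun x => ?_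
      obtain ⟨w, rfl⟩ := hyind.aevalEquiv.surjective x
      have := hyind.algebraMap_aevalEquiv w
      rw [this]
      simp
  obtain ⟨F0, ⟨hF0, hF0z⟩, hmin⟩ := WellFounded.has_min
    (measure (fun F : (MvPolynomial Y Λ)[X] => F.natDegree)).wf
    {F | F ≠ 0 ∧ evRH Λ y z0 F = 0} hex0
  have hdeg : 1 ≤ F0.natDegree := by
    by_contra hlt
    have : F0.natDegree = 0 := by omega
    obtain ⟨c, rfl⟩ := natDegree_eq_zero.mp this
    rw [evRH_C] at hF0z
    exact hF0 (by rw [(map_eq_zero_iff _ hyinj).mp hF0z, C_0])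
  let l := F0.leadingCoeff
  have hl : l ≠ 0 := leadingCoeff_ne_zero.mpr hF0
  let z := MvPolynomial.aeval y l * z0
  have hcomp : ∀ F, evRH Λ y z F = evRH Λ y z0 (F.comp (C l * X)) := by
    intro F
    rw [evRH_eq, evRH_eq, Polynomial.eval₂_comp]
    congr 1
    simp [z]
  have hM : ∀ x ∈ M, ∃ v : MvPolynomial Y Λ, v ≠ 0 ∧ ∃ F, MvPolynomial.aeval y v * x = evRH Λ y z F := by
    intro x hx
    rw [← hz0, ← IntermediateField.mem_toSubalgebra,
      IntermediateField.adjoin_simple_toSubalgebra_of_isAlgebraic (hE.isAlgebraic z0)] at hx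
    induction hx using Algebra.adjoin_induction with
    | mem x hx =>
      rw [Set.mem_singleton_iff] at hx
      exact ⟨l, hl, X, by rw [hx, evRH_X]⟩
    | algebraMap r =>
      obtain ⟨v, hv, w, hw⟩ := hfrac r r.2
      exact ⟨v, hv, C w, by rw [evRH_C]; exact hw⟩
    | add a b _ _ ha hb =>
      obtain ⟨v, hv, F, hF⟩ := ha
      obtain ⟨v', hv', F', hF'⟩ := hb
      refine ⟨v * v', mul_ne_zero hv hv', C v' * F + C v * F', ?_⟩
      rw [map_add, map_mul, map_mul, map_mul, ← hF, ← hF', evRH_C, evRH_C]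
      ring
    | mul a b _ _ ha hb =>
      obtain ⟨v, hv, F, hF⟩ := ha
      obtain ⟨v', hv', F', hF'⟩ := hb
      refine ⟨v * v', mul_ne_zero hv hv', F * F', ?_⟩
      rw [map_mul, map_mul, ← hF, ← hF']
      ring
  have hEle : E ≤ IntermediateField.adjoin Λ Gen := IntermediateField.adjoin.mono _ _ _ (by
    rintro _ ⟨i, rfl⟩; exact hYG i.2)
  have hMle : ∀ x ∈ M, x ∈ IntermediateField.adjoin Λ Gen := by
    have : M ≤ IntermediateField.extendScalars hEle := by
      rw [IntermediateField.adjoin_le_iff]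
      rintro _ ⟨a, ha, rfl⟩
      exact pow_mem (IntermediateField.subset_adjoin Λ Gen ha) _
    exact fun x hx => this hx
  refine ⟨Y, hYfin, y, z, integralNormalization F0, p ^ n, fun i => hYG i.2, hyind, ?_,
    monic_integralNormalization hF0, ?_, ?_, ?_, ?_, ?_⟩
  · refine mul_mem ?_ (hMle _ α.2)
    refine hEle (IntermediateField.algebra_adjoin_le_adjoin _ _ ?_)
    rw [Algebra.adjoin_range_eq_range_aeval]
    exact ⟨l, rfl⟩
  · have := integralNormalization_eval₂_leadingCoeff_mul hdeg
      (MvPolynomial.aeval y : MvPolynomial Y Λ →ₐ[Λ] Ω).toRingHom z0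
    rw [← evRH_eq, ← evRH_eq, hF0z, mul_zero] at this
    exact this
  · intro F hF hz
    rw [natDegree_integralNormalization]
    have hlX : (C l * X).natDegree = 1 := natDegree_C_mul_X _ hl
    have hnd : (F.comp (C l * X)).natDegree = F.natDegree := by
      rw [natDegree_comp, hlX, mul_one]
    have h1 := hmin (F.comp (C l * X)) ⟨?_, by rw [← hcomp, hz]⟩
    · change ¬ ((F.comp (C l * X)).natDegree < F0.natDegree) at h1
      rw [hnd] at h1
      omega
    · intro h0
      rcases comp_eq_zero_iff.mp h0 with h | h
      · exact hF h
      · rw [h.2, natDegree_C] at hlX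
        omega
  · exact pow_ne_zero _ (expChar_pos Ω p).ne'
  · exact fun a b => add_pow_expChar_pow a b p n
  · exact fun a ha => hM _ (IntermediateField.subset_adjoin E W ⟨a, ha, rfl⟩)
end ModD2


section ModD3

theorem exists_qP {L0 Ω σ : Type*} [CommRing L0] [IsDomain L0] [Field Ω] [Algebra L0 Ω] (y : σ → Ω) (z : Ω)
    (G : (MvPolynomial σ L0)[X]) (hG : G.Monic) (hev : evRH L0 y z G = 0)
    (hmin : ∀ F, F ≠ 0 → evRH L0 y z F = 0 → G.natDegree ≤ F.natDegree)
    (P : Ideal L0) [P.IsMaximal]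
    (hirr : Irreducible (G.map (MvPolynomial.map (Ideal.Quotient.mk P)))) :
    ∃ 𝔮 : Ideal (MvPolynomial σ L0)[X], 𝔮.IsPrime ∧ (∀ b, evRH L0 y z b = 0 → b ∈ 𝔮) ∧
      ∀ F, F ∈ 𝔮 ↔ ∃ H R, F = G * H + R ∧ ∀ e t, MvPolynomial.coeff t (R.coeff e) ∈ P := by
  let : Field (L0 ⧸ P) := Ideal.Quotient.field P
  let m : MvPolynomial σ L0 →+* MvPolynomial σ (L0 ⧸ P) := MvPolynomial.map (Ideal.Quotient.mk P)
  have hm : Function.Surjective m := MvPolynomial.map_surjective _ Ideal.Quotient.mk_surjective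
  let r : (MvPolynomial σ L0)[X] →+* (MvPolynomial σ (L0 ⧸ P))[X] := Polynomial.mapRingHom m
  have hr : Function.Surjective r := Polynomial.map_surjective _ hm
  let Gb := r G
  have hGb : Prime Gb := Irreducible.prime hirr
  have hpr : (Ideal.span {Gb}).IsPrime := (Ideal.span_singleton_prime hGb.ne_zero).mpr hGb
  have hiff : ∀ F, F ∈ (Ideal.span {Gb}).comap r ↔ ∃ H R, F = G * H + R ∧
      ∀ e t, MvPolynomial.coeff t (R.coeff e) ∈ P := by
    intro F
    have hz : ∀ R, r R = 0 ↔ ∀ e t, MvPolynomial.coeff t (R.coeff e) ∈ P := by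
      intro R
      simp only [r, coe_mapRingHom, Polynomial.ext_iff, MvPolynomial.ext_iff, Polynomial.coeff_map,
        m, MvPolynomial.coeff_map, Polynomial.coeff_zero, MvPolynomial.coeff_zero,
        Ideal.Quotient.eq_zero_iff_mem]
    rw [Ideal.mem_comap, Ideal.mem_span_singleton]
    constructor
    · rintro ⟨Hb, hHb⟩
      obtain ⟨H, rfl⟩ := hr Hb
      refine ⟨H, F - G * H, by ring, (hz _).mp ?_⟩
      rw [map_sub, hHb, map_mul, sub_self]
    · rintro ⟨H, R, rfl, hR⟩
      refine ⟨r H, ?_⟩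
      rw [map_add, (hz R).mpr hR, map_mul, add_zero]
  refine ⟨(Ideal.span {Gb}).comap r, hpr.comap r, ?_, hiff⟩
  intro b hb
  rw [hiff]
  refine ⟨b /ₘ G, 0, ?_, by simp⟩
  have h1 := modByMonic_add_div b G
  have h2 : b %ₘ G = 0 := by
    by_contra hne
    have h3 : evRH L0 y z (b %ₘ G) = 0 := by
      have := congrArg (evRH L0 y z) h1
      rw [map_add, map_mul, hev, zero_mul, add_zero, hb] at this
      exact this
    have h4 := hmin _ hne h3
    have h5 := natDegree_modByMonic_lt b hG (by
      rintro rfl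
      simp at hev)
    omega
  rw [h2, zero_add] at h1
  rw [add_zero, h1]

theorem evRH_mem_of_coeff {L0 D σ : Type*} [CommRing L0] [CommRing D] [Algebra L0 D] (y : σ → D) (z : D)
    (P : Ideal L0) (Q : Ideal D) (hPQ : ∀ a ∈ P, algebraMap L0 D a ∈ Q) (R : (MvPolynomial σ L0)[X])
    (hR : ∀ e t, MvPolynomial.coeff t (R.coeff e) ∈ P) : evRH L0 y z R ∈ Q := by
  rw [evRH_eq, Polynomial.eval₂_eq_sum_range]
  refine Ideal.sum_mem _ fun e _ => Q.mul_mem_right _ ?_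
  change MvPolynomial.aeval y (R.coeff e) ∈ Q
  rw [MvPolynomial.aeval_def, MvPolynomial.eval₂_eq]
  exact Ideal.sum_mem _ fun t _ => Q.mul_mem_right _ (hPQ _ (hR e t))

theorem evRH_comp {L0 D Ω σ : Type*} [CommRing L0] [CommRing D] [CommRing Ω] [Algebra L0 D] [Algebra L0 Ω]
    (j : D →ₐ[L0] Ω) (y : σ → D) (z : D) (F : (MvPolynomial σ L0)[X]) :
    evRH L0 (fun i => j (y i)) (j z) F = j (evRH L0 y z F) := by
  rw [evRH_eq, evRH_eq, ← AlgHom.coe_toRingHom, Polynomial.hom_eval₂]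
  congr 1
  refine MvPolynomial.ringHom_ext (fun x => ?_) (fun x => ?_)
  · simp
  · simp
end ModD3

section ModL
theorem curve_ring (K L0 : Type u) [Field K] [CommRing L0] [IsDomain L0] [Algebra K L0]
    [Algebra.FiniteType K L0] (htr : Algebra.trdeg K L0 ≤ 1) (φ : L0) (hφ : Transcendental K φ) :
    (∀ P : Ideal L0, P.IsPrime → P ≠ ⊥ → P.IsMaximal) ∧
    (∀ a : L0, a ≠ 0 → {P : MaximalSpectrum L0 | a ∈ P.asIdeal}.Finite) ∧
    Infinite (MaximalSpectrum L0) := by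
  have hnoeth : IsNoetherianRing L0 := Algebra.FiniteType.isNoetherianRing K L0
  have hjac : IsJacobsonRing L0 := isJacobsonRing_of_finiteType (A := K)
  have h1 : ∀ P : Ideal L0, P.IsPrime → P ≠ ⊥ → P.IsMaximal := by
    intro P hP hP0
    obtain ⟨s, g, hg, hg'⟩ := exists_integral_inj_algHom_of_fg K L0
    have hs : s ≤ 1 := by
      have hind : AlgebraicIndependent K (fun i => g (MvPolynomial.X i)) := by
        have : MvPolynomial.aeval (fun i => g (MvPolynomial.X i)) = g := by
          ext; simp
        rw [AlgebraicIndependent, this]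
        exact hg
      have := hind.lift_cardinalMk_le_trdeg
      have h2 : ((s : ℕ) : Cardinal.{u}) ≤ 1 := by
        simpa using this.trans (Cardinal.lift_le.mpr htr)
      exact_mod_cast h2
    have hdim : Ring.KrullDimLE 1 (MvPolynomial (Fin s) K) := by
      rw [Ring.krullDimLE_iff, MvPolynomial.ringKrullDim_of_isNoetherianRing,
        ringKrullDim_eq_zero_of_field, zero_add, Nat.card_fin]
      exact_mod_cast hs
    let : Algebra (MvPolynomial (Fin s) K) L0 := g.toRingHom.toAlgebra
    have hintegral : Algebra.IsIntegral (MvPolynomial (Fin s) K) L0 := ⟨hg'⟩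
    have hne := Ideal.IsIntegral.comap_ne_bot (R := MvPolynomial (Fin s) K) hP0
    exact Ideal.isMaximal_of_isIntegral_of_isMaximal_comap P
      (Ideal.IsPrime.isMaximal_of_ne_bot (hP.comap _) hne)
  refine ⟨h1, ?_, ?_⟩
  · intro a ha
    have hf := Ideal.finite_minimalPrimes_of_isNoetherianRing L0 (Ideal.span {a})
    refine Set.Finite.of_finite_image (f := MaximalSpectrum.asIdeal) (hf.subset ?_)
      (fun x _ y _ h => MaximalSpectrum.ext h)
    rintro _ ⟨P, hP, rfl⟩
    refine ⟨⟨P.isMaximal.isPrime, (Ideal.span_singleton_le_iff_mem _).mpr hP⟩, ?_⟩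
    rintro J ⟨hJ, haJ⟩ hJP
    have hJm := h1 J hJ (by
      rintro rfl
      exact ha (by simpa using haJ))
    exact (hJm.eq_of_le P.isMaximal.ne_top hJP).ge
  · by_contra hfin
    rw [not_infinite_iff_finite] at hfin
    have : Fintype (MaximalSpectrum L0) := Fintype.ofFinite _
    have hprod : ∏ P : MaximalSpectrum L0, P.asIdeal ≤ ⊥ := by
      have hb : (⊥ : Ideal L0).jacobson = ⊥ := hjac.out (Ideal.isPrime_bot).isRadical
      rw [← hb]
      intro x hx
      rw [Ideal.jacobson, Ideal.mem_sInf]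
      rintro J ⟨-, hJ⟩
      exact (Ideal.prod_le_inf.trans (Finset.inf_le (Finset.mem_univ (⟨J, hJ⟩ : MaximalSpectrum L0)))) hx
    rw [Ideal.IsPrime.prod_le Ideal.isPrime_bot] at hprod
    obtain ⟨P, -, hP⟩ := hprod
    have hPm := P.isMaximal
    rw [le_bot_iff.mp hP] at hPm
    have hfield := Ring.isField_iff_maximal_bot.mpr hPm
    let : Field L0 := hfield.toField
    have := finite_of_finite_type_of_isJacobsonRing K L0
    exact hφ (Algebra.IsAlgebraic.isAlgebraic (R := K) φ)
end ModL

section ModP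
theorem point_prime {K Ω : Type u} [Field K] [Field Ω] [Algebra K Ω] (A R L0 : Subalgebra K Ω)
    (hA : A.FG) (hR : R.FG) (hAR : A ≤ R) (hLR : L0 ≤ R) (hgen : R ≤ A ⊔ L0)
    (V : ValuationSubring Ω) (hRV : ∀ r ∈ R, V.valuation r ≤ 1) (m : Ideal A) [hmm : m.IsMaximal]
    (hm : ∀ a ∈ m, V.valuation (a : Ω) < 1) (hLV : ∀ l ∈ L0, l ≠ 0 → V.valuation l = 1)
    (hmax : ∀ P : Ideal L0, P.IsPrime → P ≠ ⊥ → P.IsMaximal)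
    (s : R) (hs : s ≠ 0) (P : Ideal L0) [hPm : P.IsMaximal] (hP0 : P ≠ ⊥)
    (hbad : ∀ q ∈ (Ideal.span {s}).minimalPrimes, q.comap (Subalgebra.inclusion hLR) ≠ P) :
    ∃ Q : Ideal R, Q.IsPrime ∧ Q.comap (Subalgebra.inclusion hLR) = P ∧ s ∉ Q ∧
      ∀ a : A, Subalgebra.inclusion hAR a ∈ Q → a ∈ m := by
  have hft : Algebra.FiniteType K R := R.fg_iff_finiteType.mp hR
  have hnoeth : IsNoetherianRing R := Algebra.FiniteType.isNoetherianRing K R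
  have hftA : Algebra.FiniteType K A := A.fg_iff_finiteType.mp hA
  let incl : L0 →ₐ[K] R := Subalgebra.inclusion hLR
  let 𝔭 : Ideal R := (IsLocalRing.maximalIdeal V).comap
    (R.val.toRingHom.codRestrict V.toSubring (fun r => (V.valuation_le_one_iff _).mp (hRV r r.2)))
  have h𝔭 : ∀ r : R, r ∈ 𝔭 ↔ V.valuation (r : Ω) < 1 := by
    intro r
    rw [Ideal.mem_comap, V.valuation_lt_one_iff]
    rfl
  have hpp : 𝔭.IsPrime := Ideal.IsPrime.comap _
  obtain ⟨T, _, _, mk, hmk, hker⟩ : ∃ (T : Type u) (_ : CommRing T) (_ : Algebra K T)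
      (mk : R →ₐ[K] T), Function.Surjective mk ∧ ∀ r, mk r = 0 ↔ r ∈ 𝔭 :=
    ⟨R ⧸ 𝔭, inferInstance, inferInstance, Ideal.Quotient.mkₐ K 𝔭, Ideal.Quotient.mkₐ_surjective K 𝔭,
      fun r => Ideal.Quotient.eq_zero_iff_mem⟩
  have hTdom : IsDomain T := by
    have hnt : Nontrivial T := ⟨⟨1, 0, fun h => hpp.ne_top ((Ideal.eq_top_iff_one _).mpr
      ((hker 1).mp (by rw [map_one, h])))⟩⟩
    have : NoZeroDivisors T := ⟨by
      intro a b hab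
      obtain ⟨a, rfl⟩ := hmk a
      obtain ⟨b, rfl⟩ := hmk b
      rw [← map_mul, hker] at hab
      rw [hker, hker]
      exact hpp.mem_or_mem hab⟩
    exact NoZeroDivisors.to_isDomain T
  let φ : L0 →+* T := mk.toRingHom.comp incl.toRingHom
  have hφinj : Function.Injective φ := by
    rw [injective_iff_map_eq_zero]
    intro a ha
    by_contra hne
    have h1 := (h𝔭 _).mp ((hker _).mp ha)
    have h2 := hLV a a.2 (fun h => hne (Subtype.ext h))
    change V.valuation (a : Ω) < 1 at h1
    rw [h2] at h1
    exact lt_irrefl _ h1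
  have hAint : ∀ a : A, IsIntegral K (mk (Subalgebra.inclusion hAR a)) := by
    intro a
    let : Field (A ⧸ m) := Ideal.Quotient.field m
    have : Algebra.FiniteType K (A ⧸ m) :=
      Algebra.FiniteType.of_surjective (Ideal.Quotient.mkₐ K m) (Ideal.Quotient.mkₐ_surjective K m)
    have : Module.Finite K (A ⧸ m) := finite_of_finite_type_of_isJacobsonRing K (A ⧸ m)
    have hle : ∀ a ∈ m, mk.comp (Subalgebra.inclusion hAR) a = 0 := by
      intro a ha
      exact (hker _).mpr ((h𝔭 _).mpr (hm a ha))
    let θ : A ⧸ m →ₐ[K] T := Ideal.Quotient.liftₐ m _ hle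
    have : IsIntegral K (Ideal.Quotient.mk m a) := Algebra.IsIntegral.isIntegral _
    exact this.map θ
  let : Algebra L0 T := φ.toAlgebra
  have htower : IsScalarTower K L0 T := IsScalarTower.of_algebraMap_eq (fun r => by
    rw [← mk.commutes r]; rfl)
  have hintegral : Algebra.IsIntegral L0 T := by
    refine ⟨fun x => ?_⟩
    obtain ⟨⟨r, hr⟩, rfl⟩ := hmk x
    have key : ∀ r (_ : r ∈ A ⊔ L0), ∀ hr : r ∈ R, IsIntegral L0 (mk ⟨r, hr⟩) := by
      intro r hr0
      have hsup : A ⊔ L0 ≤ R := sup_le hAR hLR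
      have : A ⊔ L0 = Algebra.adjoin K ((A : Set Ω) ∪ L0) := by
        rw [Algebra.adjoin_union, Algebra.adjoin_eq, Algebra.adjoin_eq]
      rw [this] at hr0 hsup
      induction hr0 using Algebra.adjoin_induction with
      | mem x hx =>
        intro hr
        rcases hx with hx | hx
        · exact (hAint ⟨x, hx⟩).tower_top
        · exact isIntegral_algebraMap (x := (⟨x, hx⟩ : L0))
      | algebraMap k =>
        intro hr
        exact isIntegral_algebraMap (x := (algebraMap K L0 k))
      | add a b ha hb h1 h2 =>
        intro hr
        have h3 := (h1 (hsup ha)).add (h2 (hsup hb))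
        rw [← map_add] at h3
        exact h3
      | mul a b ha hb h1 h2 =>
        intro hr
        have h3 := (h1 (hsup ha)).mul (h2 (hsup hb))
        rw [← map_mul] at h3
        exact h3
    exact key r (hgen hr) hr
  obtain ⟨N, -, hNp, hN⟩ := Ideal.exists_ideal_over_prime_of_isIntegral P (⊥ : Ideal T) (by
    intro a ha
    have : a = 0 := hφinj (by rw [map_zero]; exact ha)
    rw [this]; exact P.zero_mem)
  let 𝔫 : Ideal R := N.comap mk
  have h𝔫p : 𝔫.IsPrime := hNp.comap _
  have h𝔫 : ∀ l : L0, incl l ∈ 𝔫 ↔ l ∈ P := by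
    intro l
    rw [← hN]
    rfl
  have h𝔫m : ∀ a : A, Subalgebra.inclusion hAR a ∈ 𝔫 → a ∈ m := by
    have h1 : m ≤ 𝔫.comap (Subalgebra.inclusion hAR) := by
      intro a ha
      have h0 : mk (Subalgebra.inclusion hAR a) = 0 :=
        (hker _).mpr ((h𝔭 _).mpr (hm a ha))
      change mk (Subalgebra.inclusion hAR a) ∈ N
      rw [h0]
      exact N.zero_mem
    have h2 := hmm.eq_of_le (h𝔫p.comap (Subalgebra.inclusion hAR)).ne_top h1
    intro a ha
    rw [h2]
    exact ha
  obtain ⟨π, hπ, hπ0⟩ := Submodule.exists_mem_ne_zero_of_ne_bot hP0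
  obtain ⟨Q, hQ, hQ𝔫⟩ := Ideal.exists_minimalPrimes_le (I := Ideal.span {incl π}) (J := 𝔫)
    ((Ideal.span_singleton_le_iff_mem _).mpr ((h𝔫 π).mpr hπ))
  have hQp : Q.IsPrime := hQ.1.1
  have hπQ : incl π ∈ Q := hQ.1.2 (Ideal.mem_span_singleton_self _)
  have hQP : Q.comap incl = P := by
    have h1 : (Q.comap incl).IsPrime := hQp.comap _
    have h2 : Q.comap incl ≠ ⊥ := fun h => hπ0 (by
      have : π ∈ Q.comap incl := hπQ
      rw [h] at this
      exact this)
    refine (hmax _ h1 h2).eq_of_le hPm.ne_top ?_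
    intro l hl
    exact (h𝔫 l).mp (hQ𝔫 hl)
  refine ⟨Q, hQp, hQP, ?_, fun a ha => h𝔫m a (hQ𝔫 ha)⟩
  intro hsQ
  obtain ⟨q', hq', hq'Q⟩ := Ideal.exists_minimalPrimes_le (I := Ideal.span {s}) (J := Q)
    ((Ideal.span_singleton_le_iff_mem _).mpr hsQ)
  have hq'p : q'.IsPrime := hq'.1.1
  have heq : q' = Q := by
    by_contra hne
    have hlt : q' < Q := lt_of_le_of_ne hq'Q hne
    have hh := Ideal.height_le_one_of_isPrincipal_of_mem_minimalPrimes (Ideal.span {incl π}) Q hQ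
    have h0 : (⊥ : Ideal R) < q' := bot_lt_iff_ne_bot.mpr (fun h => hs (by
      have := hq'.1.2 (Ideal.mem_span_singleton_self s)
      rw [h] at this
      exact this))
    have hb : (⊥ : Ideal R).IsPrime := Ideal.isPrime_bot
    have e1 := Ideal.height_add_one_le_of_lt_of_isPrime h0
    have e2 := Ideal.height_add_one_le_of_lt_of_isPrime hlt
    have e3 : (1 : ℕ∞) + 1 ≤ 1 :=
      (add_le_add_left (le_add_self.trans e1) 1).trans (e2.trans hh)
    exact absurd e3 (by decide)
  exact hbad q' hq' (by rw [heq]; exact hQP)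
end ModP

section ModQ

theorem clear_denoms {K Ω : Type u} [Field K] [Field Ω] [Algebra K Ω] (R : Subalgebra K Ω)
    (S W : Set Ω) (hS : S.Finite) (hSR : ∀ x ∈ S, x ∈ IntermediateField.adjoin K (R : Set Ω))
    (hW : ∀ x ∈ W, x ∈ R) :
    ∃ s ∈ R, s ≠ 0 ∧ ∀ d ∈ Algebra.adjoin K (S ∪ W), ∃ N : ℕ, s ^ N * d ∈ R := by
  classical
  have h1 : ∀ x : S, ∃ r ∈ R, r ≠ 0 ∧ r * (x : Ω) ∈ R := by
    rintro ⟨x, hx⟩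
    have := hSR x hx
    rw [IntermediateField.mem_adjoin_iff_div, Algebra.adjoin_eq] at this
    obtain ⟨r, hr, s, hs, rfl⟩ := this
    by_cases h0 : s = 0
    · exact ⟨1, R.one_mem, one_ne_zero, by simp [h0, R.zero_mem]⟩
    · exact ⟨s, hs, h0, by simpa [mul_div_cancel₀ _ h0] using hr⟩
  choose r hrR hr0 hr using h1
  have : Fintype S := hS.fintype
  have hsR : ∏ x : S, r x ∈ R := Subalgebra.prod_mem _ fun x _ => hrR x
  refine ⟨∏ x : S, r x, hsR, Finset.prod_ne_zero_iff.mpr fun x _ => hr0 x, ?_⟩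
  intro d hd
  induction hd using Algebra.adjoin_induction with
  | mem x hx =>
    rcases hx with hx | hx
    · refine ⟨1, ?_⟩
      rw [pow_one, ← Finset.prod_erase_mul _ _ (Finset.mem_univ (⟨x, hx⟩ : S)), mul_assoc]
      exact R.mul_mem (Subalgebra.prod_mem _ fun x _ => hrR x) (hr ⟨x, hx⟩)
    · exact ⟨0, by simpa using hW x hx⟩
  | algebraMap k => exact ⟨0, by simp [R.algebraMap_mem]⟩
  | add a b _ _ ha hb =>
    obtain ⟨N, hN⟩ := ha
    obtain ⟨M, hM⟩ := hb
    refine ⟨N + M, ?_⟩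
    have := R.add_mem (R.mul_mem (R.pow_mem hsR M) hN) (R.mul_mem (R.pow_mem hsR N) hM)
    convert this using 1
    ring
  | mul a b _ _ ha hb =>
    obtain ⟨N, hN⟩ := ha
    obtain ⟨M, hM⟩ := hb
    refine ⟨N + M, ?_⟩
    have := R.mul_mem hN hM
    convert this using 1
    ring

theorem adjoin_descend {K Ω : Type u} [Field K] [Field Ω] [Algebra K Ω] (Λ : IntermediateField K Ω)
    (S : Set Ω) (x : Ω) (hx : x ∈ Algebra.adjoin Λ S) :
    ∃ T : Set Ω, T.Finite ∧ (∀ t ∈ T, t ∈ Λ) ∧ x ∈ Algebra.adjoin K (S ∪ T) := by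
  induction hx using Algebra.adjoin_induction with
  | mem x hx => exact ⟨∅, Set.finite_empty, by simp, Algebra.subset_adjoin (Or.inl hx)⟩
  | algebraMap k => exact ⟨{(k : Ω)}, Set.finite_singleton _, by simp,
      Algebra.subset_adjoin (Or.inr rfl)⟩
  | add a b _ _ ha hb =>
    obtain ⟨T, hT, hT', h⟩ := ha
    obtain ⟨U, hU, hU', h'⟩ := hb
    refine ⟨T ∪ U, hT.union hU, fun t ht => ht.elim (hT' t) (hU' t), add_mem ?_ ?_⟩
    · exact Algebra.adjoin_mono (by grind) h
    · exact Algebra.adjoin_mono (by grind) h'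
  | mul a b _ _ ha hb =>
    obtain ⟨T, hT, hT', h⟩ := ha
    obtain ⟨U, hU, hU', h'⟩ := hb
    refine ⟨T ∪ U, hT.union hU, fun t ht => ht.elim (hT' t) (hU' t), mul_mem ?_ ?_⟩
    · exact Algebra.adjoin_mono (by grind) h
    · exact Algebra.adjoin_mono (by grind) h'

theorem coeffs_finite {σ R : Type*} [CommRing R] (F : (MvPolynomial σ R)[X]) :
    (Set.range (fun x : ℕ × (σ →₀ ℕ) => MvPolynomial.coeff x.2 (F.coeff x.1))).Finite := by
  classical
  refine Set.Finite.subset (s := {0} ∪ ⋃ e ∈ F.support, (fun t => MvPolynomial.coeff t (F.coeff e)) ''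
    (F.coeff e).support) ?_ ?_
  · refine (Set.finite_singleton _).union (Set.Finite.biUnion F.support.finite_toSet fun e _ => ?_)
    exact (F.coeff e).support.finite_toSet.image _
  · rintro _ ⟨⟨e, t⟩, rfl⟩
    by_cases h : MvPolynomial.coeff t (F.coeff e) = 0
    · exact Or.inl h
    · refine Or.inr (Set.mem_biUnion (x := e) ?_ ⟨t, ?_, rfl⟩)
      · rw [Finset.mem_coe, mem_support_iff]
        intro h0
        exact h (by rw [h0, MvPolynomial.coeff_zero])
      · rw [Finset.mem_coe, MvPolynomial.mem_support_iff]
        exact h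

theorem exists_lift_coeffs {σ R S : Type*} [CommRing R] [CommRing S] (f : R →+* S)
    (F : (MvPolynomial σ S)[X]) (h : ∀ e t, MvPolynomial.coeff t (F.coeff e) ∈ f.range) :
    ∃ F0 : (MvPolynomial σ R)[X], F0.map (MvPolynomial.map f) = F := by
  have h1 : ∀ e, ∃ p : MvPolynomial σ R, MvPolynomial.map f p = F.coeff e := by
    intro e
    choose c hc using h e
    refine ⟨∑ t ∈ (F.coeff e).support, MvPolynomial.monomial t (c t), ?_⟩
    rw [map_sum]
    conv_rhs => rw [MvPolynomial.as_sum (F.coeff e)]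
    exact Finset.sum_congr rfl fun t _ => by rw [MvPolynomial.map_monomial, hc]
  choose p hp using h1
  refine ⟨∑ e ∈ F.support, Polynomial.monomial e (p e), ?_⟩
  rw [Polynomial.map_sum]
  conv_rhs => rw [F.as_sum_support]
  exact Finset.sum_congr rfl fun t _ => by rw [Polynomial.map_monomial, hp]
end ModQ

end Alg

section ModR

theorem core_final {K Ω : Type u} [Field K] [Field Ω] [Algebra K Ω] {ι : Type*} [Finite ι] [Nonempty ι]
    (A : ι → Subalgebra K Ω) (hA : ∀ i, (A i).FG) (V : ι → ValuationSubring Ω)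
    (m : ∀ i, Ideal (A i)) (hm : ∀ i, (m i).IsMaximal)
    (hAV : ∀ i, ∀ a ∈ A i, (V i).valuation a ≤ 1)
    (hmV : ∀ i, ∀ a ∈ m i, (V i).valuation (a : Ω) < 1)
    (L0 : Subalgebra K Ω) (hL0 : L0.FG) (hLV : ∀ i, ∀ l ∈ L0, l ≠ 0 → (V i).valuation l = 1)
    (hmax : ∀ P : Ideal L0, P.IsPrime → P ≠ ⊥ → P.IsMaximal)
    (hinf : Infinite (MaximalSpectrum L0))
    {σ : Type u} (y : σ → Ω) (z : Ω) (G : (MvPolynomial σ L0)[X]) (hG : G.Monic)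
    (hev : evRH L0 y z G = 0)
    (hmin : ∀ F, F ≠ 0 → evRH L0 y z F = 0 → G.natDegree ≤ F.natDegree)
    (hirr : {P : MaximalSpectrum L0 |
      ¬ Irreducible (G.map (MvPolynomial.map (Ideal.Quotient.mk P.asIdeal)))}.Finite)
    (S0 : MvPolynomial σ L0) (hS0 : MvPolynomial.aeval y S0 ≠ 0)
    (q : ℕ) (hq : q ≠ 0) (hadd : ∀ x y : Ω, (x + y) ^ q = x ^ q + y ^ q)
    (D : Subalgebra K Ω) (hLD : L0 ≤ D) (hyD : ∀ i, y i ∈ D) (hzD : z ∈ D)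
    (hSD : (MvPolynomial.aeval y S0)⁻¹ ∈ D) (hAD : ∀ i, A i ≤ D)
    (hDq : ∀ d ∈ D, ∃ (N : ℕ) (F : (MvPolynomial σ L0)[X]),
      evRH L0 y z (C S0) ^ N * d ^ q = evRH L0 y z F)
    (hDi : ∀ i, ∃ s ∈ A i ⊔ L0, s ≠ 0 ∧ ∀ d ∈ D, ∃ N : ℕ, s ^ N * d ∈ A i ⊔ L0) :
    ∃ Q : Ideal D, Q.IsPrime ∧ Q ≠ ⊥ ∧
      ∀ i (a : A i), Subalgebra.inclusion (hAD i) a ∈ Q → a ∈ m i := by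
  choose s hsR hs0 hs using hDi
  let R : ι → Subalgebra K Ω := fun i => A i ⊔ L0
  have hRFG : ∀ i, (R i).FG := fun i => (hA i).sup hL0
  have hRN : ∀ i, IsNoetherianRing (R i) := fun i => by
    have : Algebra.FiniteType K (R i) := (R i).fg_iff_finiteType.mp (hRFG i)
    exact Algebra.FiniteType.isNoetherianRing K (R i)
  let bad : ι → Set (MaximalSpectrum L0) := fun i => {P | ∃ p ∈ (Ideal.span {(⟨s i, hsR i⟩ : R i)}).minimalPrimes,
    p.comap (Subalgebra.inclusion (le_sup_right : L0 ≤ R i)) = P.asIdeal}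
  have hbad : ∀ i, (bad i).Finite := by
    intro i
    have hf := Ideal.finite_minimalPrimes_of_isNoetherianRing (R i) (Ideal.span {(⟨s i, hsR i⟩ : R i)})
    refine Set.Finite.of_finite_image (f := MaximalSpectrum.asIdeal)
      ((hf.image (fun p => p.comap (Subalgebra.inclusion (le_sup_right : L0 ≤ R i)))).subset ?_)
      (fun x _ y _ h => MaximalSpectrum.ext h)
    rintro _ ⟨P, ⟨p, hp, hpP⟩, rfl⟩
    exact ⟨p, hp, hpP⟩
  have hbot : {P : MaximalSpectrum L0 | P.asIdeal = ⊥}.Finite :=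
    Set.Subsingleton.finite (fun x hx y hy => MaximalSpectrum.ext (hx.trans hy.symm))
  obtain ⟨P, hP⟩ := ((hirr.union hbot).union (Set.finite_iUnion hbad)).infinite_compl.nonempty
  simp only [Set.mem_compl_iff, Set.mem_union, Set.mem_iUnion, not_or, not_exists] at hP
  obtain ⟨⟨hPirr, hP0⟩, hPbad⟩ := hP
  have hPirr : Irreducible (G.map (MvPolynomial.map (Ideal.Quotient.mk P.asIdeal))) := not_not.mp hPirr
  have hP0 : P.asIdeal ≠ ⊥ := hP0
  have hPm := P.isMaximal
  have hRV : ∀ i, ∀ r ∈ R i, (V i).valuation r ≤ 1 := by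
    intro i r hr
    let W : Subalgebra K Ω :=
      { (V i).toSubring with
        algebraMap_mem' := fun k => ((V i).valuation_le_one_iff _).mp (hAV i _ ((A i).algebraMap_mem k)) }
    have : R i ≤ W := sup_le (fun a ha => ((V i).valuation_le_one_iff _).mp (hAV i a ha))
      (fun l hl => ((V i).valuation_le_one_iff _).mp (by
        by_cases h0 : l = 0
        · rw [h0, map_zero]; exact zero_le_one
        · exact (hLV i l hl h0).le))
    exact ((V i).valuation_le_one_iff _).mpr (this hr)
  have hQi : ∀ i, ∃ Q' : Ideal D, Q'.IsPrime ∧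
      (∀ l : L0, l ∈ P.asIdeal → Subalgebra.inclusion hLD l ∈ Q') ∧
      ∀ a : A i, Subalgebra.inclusion (hAD i) a ∈ Q' → a ∈ m i := by
    intro i
    have hmi := hm i
    obtain ⟨Qi, hQip, hQiP, hsQ, hQim⟩ := point_prime (A i) (R i) L0 (hA i) (hRFG i) le_sup_left
      le_sup_right le_rfl (V i) (hRV i) (m i) (hmV i) (hLV i) hmax ⟨s i, hsR i⟩
      (fun h => hs0 i (congrArg Subtype.val h)) P.asIdeal hP0
      (fun p hp hpP => hPbad i ⟨p, hp, hpP⟩)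
    obtain ⟨Q', hQ'p, hQ'⟩ := exists_prime_of_ev D.val.toRingHom (R i).val.toRingHom Qi
      (fun b hb => by
        have : b = 0 := Subtype.ext hb
        rw [this]; exact Qi.zero_mem) ⟨s i, hsR i⟩ hsQ 1 one_ne_zero (by simp)
      (fun d => by
        obtain ⟨N, hN⟩ := hs i d d.2
        refine ⟨N, ⟨_, hN⟩, ?_⟩
        rw [pow_one]; rfl)
    refine ⟨Q', hQ'p, ?_, ?_⟩
    · intro l hl
      rw [hQ']
      refine ⟨0, Subalgebra.inclusion le_sup_right l, ?_, ?_⟩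
      · rw [← hQiP] at hl
        exact hl
      · rw [pow_zero, pow_one, one_mul]; rfl
    · intro a ha
      rw [hQ'] at ha
      obtain ⟨N, F, hF, h⟩ := ha
      refine hQim a ?_
      have : (⟨s i, hsR i⟩ : R i) ^ N * Subalgebra.inclusion le_sup_left a = F := by
        refine Subtype.ext ?_
        rw [pow_one] at h
        exact h
      rw [← this] at hF
      rcases hQip.mem_or_mem hF with h1 | h1
      · exact absurd (hQip.mem_of_pow_mem N h1) hsQ
      · exact h1
  choose Q' hQ'p hQ'P hQ'm using hQi
  obtain ⟨𝔮, h𝔮p, h𝔮ker, h𝔮⟩ := exists_qP y z G hG hev hmin P.asIdeal hPirr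
  let : Algebra L0 D := (Subalgebra.inclusion hLD).toRingHom.toAlgebra
  let jD : D →ₐ[L0] Ω := { D.val.toRingHom with commutes' := fun r => rfl }
  let yD : σ → D := fun i => ⟨y i, hyD i⟩
  let zD : D := ⟨z, hzD⟩
  have hevD : ∀ F, jD (evRH L0 yD zD F) = evRH L0 y z F := fun F => (evRH_comp jD yD zD F).symm
  have hjinj : Function.Injective jD := Subtype.val_injective
  have hmemQ' : ∀ i, ∀ F ∈ 𝔮, evRH L0 yD zD F ∈ Q' i := by
    intro i F hF
    obtain ⟨H, Rm, rfl, hRm⟩ := (h𝔮 F).mp hF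
    have h0 : evRH L0 yD zD G = 0 := hjinj (by rw [hevD, hev, map_zero])
    rw [map_add, map_mul, h0, zero_mul, zero_add]
    exact evRH_mem_of_coeff yD zD P.asIdeal (Q' i) (fun a ha => hQ'P i a ha) Rm hRm
  let sD : D := evRH L0 yD zD (C S0)
  have hsDval : jD sD = MvPolynomial.aeval y S0 := by rw [hevD, evRH_C]
  have hsunit : IsUnit sD := by
    refine IsUnit.of_mul_eq_one ⟨_, hSD⟩ (hjinj ?_)
    rw [map_mul, hsDval, map_one]
    exact mul_inv_cancel₀ hS0
  have hsQ' : ∀ i, sD ∉ Q' i := fun i h => (hQ'p i).ne_top (Ideal.eq_top_of_isUnit_mem _ h hsunit)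
  obtain ⟨i0⟩ := ‹Nonempty ι›
  obtain ⟨Q, hQp, hQ⟩ := exists_prime_of_ev D.val.toRingHom (evRH L0 y z) 𝔮 h𝔮ker (C S0)
    (fun h => hsQ' i0 (hmemQ' i0 _ h)) q hq hadd (fun d => hDq d d.2)
  refine ⟨Q, hQp, ?_, ?_⟩
  · obtain ⟨π, hπ, hπ0⟩ := Submodule.exists_mem_ne_zero_of_ne_bot hP0
    intro hQ0
    have hmem : Subalgebra.inclusion hLD π ∈ Q := by
      rw [hQ]
      refine ⟨0, C (MvPolynomial.C π) ^ q, 𝔮.pow_mem_of_mem ?_ q (Nat.pos_of_ne_zero hq), ?_⟩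
      · rw [h𝔮]
        refine ⟨0, C (MvPolynomial.C π), by ring, ?_⟩
        intro e t
        classical
        rw [Polynomial.coeff_C]
        split_ifs
        · rw [MvPolynomial.coeff_C]
          split_ifs
          · exact hπ
          · exact P.asIdeal.zero_mem
        · rw [MvPolynomial.coeff_zero]
          exact P.asIdeal.zero_mem
      · rw [pow_zero, one_mul, map_pow, evRH_C, MvPolynomial.aeval_C]
        rfl
    rw [hQ0, Ideal.mem_bot] at hmem
    exact hπ0 (Subalgebra.inclusion_injective hLD (by rw [hmem, map_zero]))
  · intro i a ha
    refine hQ'm i a ?_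
    rw [hQ] at ha
    obtain ⟨N, F, hF, h⟩ := ha
    have h1 := hmemQ' i F hF
    have h2 : evRH L0 yD zD F = sD ^ N * (Subalgebra.inclusion (hAD i) a) ^ q := by
      refine hjinj ?_
      rw [hevD, ← h, map_mul, map_pow, map_pow, hevD]
      rfl
    rw [h2] at h1
    rcases (hQ'p i).mem_or_mem h1 with h3 | h3
    · exact absurd ((hQ'p i).mem_of_pow_mem N h3) (hsQ' i)
    · exact (hQ'p i).mem_of_pow_mem q h3
end ModR

section ModS

theorem core2 {K Ω : Type u} [Field K] [Field Ω] [Algebra K Ω] {ι : Type*} [Finite ι] [Nonempty ι]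
    (A : ι → Subalgebra K Ω) (hA : ∀ i, (A i).FG)
    (hfrac : ∀ i j, ∀ a ∈ A j, ∃ s ∈ A i, s ≠ 0 ∧ s * a ∈ A i)
    (halg : ∀ i, Algebra.IsAlgebraic (A i) Ω) (V : ι → ValuationSubring Ω)
    (m : ∀ i, Ideal (A i)) (hm : ∀ i, (m i).IsMaximal)
    (hAV : ∀ i, ∀ a ∈ A i, (V i).valuation a ≤ 1)
    (hmV : ∀ i, ∀ a ∈ m i, (V i).valuation (a : Ω) < 1)
    (Λ : IntermediateField K Ω) [IsAlgClosed Λ] (hΛV : ∀ i, ∀ l ∈ Λ, l ≠ 0 → (V i).valuation l = 1)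
    (ψ : Ω) (hψ : ψ ∈ Λ) (hψt : Transcendental K ψ) (htr : Algebra.trdeg K Λ ≤ 1) :
    ∃ (D : Subalgebra K Ω) (hAD : ∀ i, A i ≤ D) (Q : Ideal D), Q.IsPrime ∧ Q ≠ ⊥ ∧
      ∀ i (a : A i), Subalgebra.inclusion (hAD i) a ∈ Q → a ∈ m i := by
  classical
  obtain ⟨i0⟩ := ‹Nonempty ι›
  choose gen hgen using hA
  let Gen : Set Ω := ⋃ i, (gen i : Set Ω)
  have hGenfin : Gen.Finite := Set.finite_iUnion fun i => (gen i).finite_toSet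
  have hgG : ∀ i, (gen i : Set Ω) ⊆ Gen := fun i => Set.subset_iUnion (fun i => (gen i : Set Ω)) i
  have hGenA : ∀ a ∈ Gen, ∃ i, a ∈ A i := by
    intro a ha
    obtain ⟨i, hi⟩ := Set.mem_iUnion.mp ha
    exact ⟨i, by rw [← hgen i]; exact Algebra.subset_adjoin hi⟩
  have hAle : ∀ (i) (W : Subalgebra K Ω), Gen ⊆ W → A i ≤ W := by
    intro i W hW
    rw [← hgen i]
    exact Algebra.adjoin_le ((hgG i).trans hW)
  have halgG : Algebra.IsAlgebraic (Algebra.adjoin Λ Gen) Ω := by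
    have hle : A i0 ≤ (Algebra.adjoin Λ Gen).restrictScalars K := hAle i0 _ Algebra.subset_adjoin
    let : Algebra (A i0) (Algebra.adjoin Λ Gen) := (Subalgebra.inclusion hle).toRingHom.toAlgebra
    have : IsScalarTower (A i0) (Algebra.adjoin Λ Gen) Ω := IsScalarTower.of_algebraMap_eq (fun _ => rfl)
    have := halg i0
    exact Algebra.IsAlgebraic.extendScalars (R := A i0) (S := Algebra.adjoin Λ Gen)
      (Subalgebra.inclusion_injective hle)
  obtain ⟨σ, hσ, y, z, G, q, hyG, hyind, hz, hG, hev, hmin, hq, hadd, hGen⟩ :=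
    field_model (Λ := Λ) Gen hGenfin
  choose! v hv0 F hF using hGen
  rw [IntermediateField.mem_adjoin_iff_div] at hz
  obtain ⟨zn, hzn, zd, hzd, hzeq⟩ := hz
  obtain ⟨T1, hT1, hT1Λ, hznT⟩ := adjoin_descend Λ Gen zn hzn
  obtain ⟨T2, hT2, hT2Λ, hzdT⟩ := adjoin_descend Λ Gen zd hzd
  let co : (MvPolynomial σ Λ)[X] → Set Ω := fun F =>
    (fun l : Λ => (l : Ω)) '' (Set.range (fun x : ℕ × (σ →₀ ℕ) => MvPolynomial.coeff x.2 (F.coeff x.1)))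
  have hcofin : ∀ F, (co F).Finite := fun F => (coeffs_finite F).image _
  have hcoΛ : ∀ F, co F ⊆ Λ := by
    rintro F _ ⟨l, -, rfl⟩
    exact l.2
  let Co : Set Ω := T1 ∪ T2 ∪ {ψ} ∪ co G ∪ (⋃ a ∈ Gen, co (F a)) ∪ (⋃ a ∈ Gen, co (C (v a)))
  have hCofin : Co.Finite := by
    refine ((((hT1.union hT2).union (Set.finite_singleton _)).union (hcofin G)).union ?_).union ?_
    · exact hGenfin.biUnion fun a _ => hcofin _
    · exact hGenfin.biUnion fun a _ => hcofin _
  have hCoΛ : Co ⊆ Λ := by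
    refine Set.union_subset (Set.union_subset (Set.union_subset (Set.union_subset (Set.union_subset
      hT1Λ hT2Λ) (Set.singleton_subset_iff.mpr hψ)) (hcoΛ G)) ?_) ?_
    · exact Set.iUnion₂_subset fun a _ => hcoΛ _
    · exact Set.iUnion₂_subset fun a _ => hcoΛ _
  let L0 : Subalgebra K Ω := Algebra.adjoin K Co
  have hCoL : Co ⊆ L0 := Algebra.subset_adjoin
  have hL0FG : L0.FG := ⟨hCofin.toFinset, by rw [hCofin.coe_toFinset]⟩
  have hL0Λ : L0 ≤ Λ.toSubalgebra := Algebra.adjoin_le hCoΛ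
  have hψL : ψ ∈ L0 := hCoL (by simp [Co])
  let : Algebra L0 Λ := (Subalgebra.inclusion hL0Λ).toRingHom.toAlgebra
  have htow : IsScalarTower L0 Λ Ω := IsScalarTower.of_algebraMap_eq (fun _ => rfl)
  have htow' : IsScalarTower K L0 Λ := IsScalarTower.of_algebraMap_eq (fun _ => rfl)
  have hLΛinj : Function.Injective (algebraMap L0 Λ) := Subalgebra.inclusion_injective hL0Λ
  have hmapinj : Function.Injective (MvPolynomial.map (σ := σ) (algebraMap L0 Λ)) :=
    MvPolynomial.map_injective _ hLΛinj
  have hlift : ∀ F : (MvPolynomial σ Λ)[X], co F ⊆ Co →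
      ∃ F0 : (MvPolynomial σ L0)[X], F0.map (MvPolynomial.map (algebraMap L0 Λ)) = F := by
    intro F hFC
    refine exists_lift_coeffs _ F fun e t => ?_
    exact ⟨⟨_, hCoL (hFC ⟨_, ⟨(e, t), rfl⟩, rfl⟩)⟩, rfl⟩
  obtain ⟨G0, hG0⟩ := hlift G (by intro x hx; simp only [Co, Set.mem_union]; tauto)
  have hF0 : ∀ a ∈ Gen, ∃ F0 : (MvPolynomial σ L0)[X],
      F0.map (MvPolynomial.map (algebraMap L0 Λ)) = F a := fun a ha => hlift _ (by
    intro x hx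
    have : x ∈ ⋃ a ∈ Gen, co (F a) := Set.mem_biUnion ha hx
    simp only [Co, Set.mem_union]; tauto)
  have hv0' : ∀ a ∈ Gen, ∃ v0 : MvPolynomial σ L0, MvPolynomial.map (algebraMap L0 Λ) v0 = v a := by
    intro a ha
    obtain ⟨w, hw⟩ := hlift (C (v a)) (by
      intro x hx
      have : x ∈ ⋃ a ∈ Gen, co (C (v a)) := Set.mem_biUnion ha hx
      simp only [Co, Set.mem_union]; tauto)
    refine ⟨w.coeff 0, ?_⟩
    rw [← Polynomial.coeff_map, hw, Polynomial.coeff_C_zero]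
  choose! F0 hF0 using hF0
  choose! v0 hv0' using hv0'
  have hft : Algebra.FiniteType K L0 := L0.fg_iff_finiteType.mp hL0FG
  have htr0 : Algebra.trdeg K L0 ≤ 1 :=
    (trdeg_le_of_injective (Subalgebra.inclusion hL0Λ) (Subalgebra.inclusion_injective hL0Λ)).trans htr
  have hψ0 : Transcendental K (⟨ψ, hψL⟩ : L0) := by
    intro h
    exact hψt (h.algHom L0.val)
  obtain ⟨hmax, hfinP, hinf⟩ := curve_ring K L0 htr0 ⟨ψ, hψL⟩ hψ0
  have hG0m : G0.Monic := Polynomial.monic_of_injective hmapinj (by rw [hG0]; exact hG)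
  have hdeg : ∀ F : (MvPolynomial σ L0)[X],
      (F.map (MvPolynomial.map (algebraMap L0 Λ))).natDegree = F.natDegree :=
    fun F => Polynomial.natDegree_map_eq_of_injective hmapinj F
  have hev0 : evRH L0 y z G0 = 0 := by rw [← evRH_map (R' := Λ), hG0, hev]
  have hmin0 : ∀ F, F ≠ 0 → evRH L0 y z F = 0 → G0.natDegree ≤ F.natDegree := by
    intro F hF0 hF
    rw [← hdeg G0, ← hdeg F, hG0]
    refine hmin _ ?_ (by rw [evRH_map, hF])
    rwa [Ne, Polynomial.map_eq_zero_iff hmapinj]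
  have hdeg0 : G0.natDegree ≠ 0 := by
    intro h
    have h1 : G0 = 1 := hG0m.natDegree_eq_zero.mp h
    rw [h1, map_one] at hev0
    exact one_ne_zero hev0
  have hirr : {P : MaximalSpectrum L0 |
      ¬ Irreducible (G0.map (MvPolynomial.map (Ideal.Quotient.mk P.asIdeal)))}.Finite := by
    by_contra hcon
    have hI : Infinite {P : MaximalSpectrum L0 |
      ¬ Irreducible (G0.map (MvPolynomial.map (Ideal.Quotient.mk P.asIdeal)))} :=
      Set.infinite_coe_iff.mpr hcon
    let : ∀ i : {P : MaximalSpectrum L0 |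
      ¬ Irreducible (G0.map (MvPolynomial.map (Ideal.Quotient.mk P.asIdeal)))},
      Field (L0 ⧸ i.1.asIdeal) := fun i => Ideal.Quotient.field i.1.asIdeal
    obtain ⟨G1, G2, hG1, hG2, hmul, hd1, hd2⟩ := spread L0 Λ _ hLΛinj
      (fun i : {P : MaximalSpectrum L0 |
      ¬ Irreducible (G0.map (MvPolynomial.map (Ideal.Quotient.mk P.asIdeal)))} => L0 ⧸ i.1.asIdeal)
      (fun i => Ideal.Quotient.mk i.1.asIdeal) (fun a ha => by
        have h2 := (hfinP a ha).preimage (Subtype.val_injective (p := fun P =>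
          P ∈ {P : MaximalSpectrum L0 |
      ¬ Irreducible (G0.map (MvPolynomial.map (Ideal.Quotient.mk P.asIdeal)))})).injOn
        refine h2.subset ?_
        intro i hi
        exact Ideal.Quotient.eq_zero_iff_mem.mp hi) G0 hG0m hdeg0 (fun i => i.2)
    have h3 : evRH Λ y z G1 * evRH Λ y z G2 = 0 := by
      rw [← map_mul, hmul, hG0, hev]
    rw [← hdeg G0, hG0] at hd1 hd2
    rcases mul_eq_zero.mp h3 with h | h
    · exact absurd (hmin G1 hG1.ne_zero h) (not_le.mpr hd1)
    · exact absurd (hmin G2 hG2.ne_zero h) (not_le.mpr hd2)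
  let S0 : MvPolynomial σ L0 := ∏ a ∈ hGenfin.toFinset, v0 a
  have haev : ∀ p : MvPolynomial σ L0, p ≠ 0 → MvPolynomial.aeval y p ≠ 0 := by
    intro p hp h
    apply hp
    apply hmapinj
    rw [map_zero]
    apply hyind
    rw [map_zero, ← h, MvPolynomial.aeval_map_algebraMap]
  have hv00 : ∀ a ∈ Gen, v0 a ≠ 0 := by
    intro a ha h
    apply hv0 a ha
    rw [← hv0' a ha, h, map_zero]
  have hS0 : MvPolynomial.aeval y S0 ≠ 0 := by
    apply haev
    exact Finset.prod_ne_zero_iff.mpr fun a ha => hv00 a (hGenfin.mem_toFinset.mp ha)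
  have haevmem : ∀ W : Subalgebra K Ω, L0 ≤ W → Gen ⊆ W → ∀ p : MvPolynomial σ L0,
      MvPolynomial.aeval y p ∈ W := by
    intro W hLW hGW p
    induction p using MvPolynomial.induction_on with
    | C a => rw [MvPolynomial.aeval_C]; exact hLW a.2
    | add p q hp hq => rw [map_add]; exact W.add_mem hp hq
    | mul_X p i hp => rw [map_mul, MvPolynomial.aeval_X]; exact W.mul_mem hp (hGW (hyG i))
  let s : Ω := MvPolynomial.aeval y S0
  let D : Subalgebra K Ω := Algebra.adjoin K ((Gen ∪ {z, s⁻¹}) ∪ L0)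
  have hGD : Gen ⊆ D := fun a ha => Algebra.subset_adjoin (Or.inl (Or.inl ha))
  have hLD : L0 ≤ D := fun a ha => Algebra.subset_adjoin (Or.inr ha)
  have hzD : z ∈ D := Algebra.subset_adjoin (Or.inl (Or.inr (by simp)))
  have hsD : s⁻¹ ∈ D := Algebra.subset_adjoin (Or.inl (Or.inr (by simp)))
  have hAD : ∀ i, A i ≤ D := fun i => hAle i D hGD
  refine ⟨D, hAD, ?_⟩
  have hDi : ∀ i, ∃ s ∈ A i ⊔ L0, s ≠ 0 ∧ ∀ d ∈ D, ∃ N : ℕ, s ^ N * d ∈ A i ⊔ L0 := by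
    intro i
    refine clear_denoms (A i ⊔ L0) (Gen ∪ {z, s⁻¹}) L0
      (hGenfin.union (Set.toFinite _)) ?_ (fun x hx => (le_sup_right : L0 ≤ A i ⊔ L0) hx)
    let E := IntermediateField.adjoin K ((A i ⊔ L0 : Subalgebra K Ω) : Set Ω)
    have hAE : ∀ a ∈ A i, a ∈ E := fun a ha =>
      IntermediateField.subset_adjoin _ _ ((le_sup_left : A i ≤ A i ⊔ L0) ha)
    have hLE : L0 ≤ E.toSubalgebra := fun a ha =>
      IntermediateField.subset_adjoin _ _ ((le_sup_right : L0 ≤ A i ⊔ L0) ha)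
    have hGE : Gen ⊆ E.toSubalgebra := by
      intro a ha
      obtain ⟨j, hj⟩ := hGenA a ha
      obtain ⟨r, hr, hr0, hra⟩ := hfrac i j a hj
      have : a = r * a / r := by field_simp
      rw [this]
      exact E.div_mem (hAE _ hra) (hAE _ hr)
    have hT1C : T1 ⊆ L0 := fun t ht => hCoL (by simp only [Co, Set.mem_union]; tauto)
    have hT2C : T2 ⊆ L0 := fun t ht => hCoL (by simp only [Co, Set.mem_union]; tauto)
    rintro x (hx | hx)
    · exact hGE hx
    · rcases hx with rfl | hx
      · rw [hzeq]
        refine E.div_mem ?_ ?_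
        · exact Algebra.adjoin_le (S := E.toSubalgebra) (Set.union_subset hGE (hT1C.trans hLE)) hznT
        · exact Algebra.adjoin_le (S := E.toSubalgebra) (Set.union_subset hGE (hT2C.trans hLE)) hzdT
      · rw [Set.mem_singleton_iff] at hx
        rw [hx]
        exact E.inv_mem (haevmem E.toSubalgebra hLE hGE S0)
  have hDq : ∀ d ∈ D, ∃ (N : ℕ) (F : (MvPolynomial σ L0)[X]),
      evRH L0 y z (C S0) ^ N * d ^ q = evRH L0 y z F := by
    intro d hd
    have hL0q : ∀ l ∈ L0, ∃ (N : ℕ) (F : (MvPolynomial σ L0)[X]),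
      evRH L0 y z (C S0) ^ N * l ^ q = evRH L0 y z F := by
      intro l hl
      refine ⟨0, C (MvPolynomial.C (⟨l, hl⟩ ^ q)), ?_⟩
      rw [evRH_C, pow_zero, one_mul, evRH_C, MvPolynomial.aeval_C, map_pow]
      rfl
    induction hd using Algebra.adjoin_induction with
    | mem d hd =>
      rcases hd with (hd | hd) | hd
      · refine ⟨1, C (∏ a ∈ hGenfin.toFinset.erase d, v0 a) * F0 d, ?_⟩
        rw [map_mul, evRH_C, evRH_C, pow_one, ← evRH_map (R' := Λ) y z (F0 d), hF0 d hd, ← hF d hd,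
          ← hv0' d hd, MvPolynomial.aeval_map_algebraMap, ← mul_assoc, ← map_mul,
          Finset.prod_erase_mul _ _ (hGenfin.mem_toFinset.mpr hd)]
      · rcases hd with rfl | hd
        · refine ⟨0, X ^ q, ?_⟩
          rw [pow_zero, one_mul, map_pow, evRH_X]
        · rw [Set.mem_singleton_iff] at hd
          refine ⟨q, 1, ?_⟩
          rw [map_one, hd, evRH_C, ← mul_pow, mul_inv_cancel₀ hS0, one_pow]
      · exact hL0q d hd
    | algebraMap k => exact hL0q _ (L0.algebraMap_mem k)
    | add a b _ _ ha hb =>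
      obtain ⟨N, F, h⟩ := ha
      obtain ⟨N', F', h'⟩ := hb
      refine ⟨N + N', (C S0) ^ N' * F + (C S0) ^ N * F', ?_⟩
      rw [map_add, map_mul, map_mul, ← h, ← h', hadd, map_pow, map_pow]
      ring
    | mul a b _ _ ha hb =>
      obtain ⟨N, F, h⟩ := ha
      obtain ⟨N', F', h'⟩ := hb
      refine ⟨N + N', F * F', ?_⟩
      rw [map_mul, ← h, ← h']
      ring
  exact core_final A (fun i => ⟨gen i, hgen i⟩) V m hm hAV hmV L0 hL0FG
    (fun i l hl => hΛV i l (hL0Λ hl)) hmax hinf y z G0 hG0m hev0 hmin0 hirr S0 hS0 q hq hadd D hLD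
    (fun i => hGD (hyG i)) hzD hsD hAD hDq hDi
end ModS

section ModT
theorem trdeg_le_of_alg {K E L : Type u} [Field K] [Field E] [Field L] [Algebra K E] [Algebra E L]
    [Algebra K L] [IsScalarTower K E L] [Algebra.IsAlgebraic E L] (h : Algebra.trdeg K E ≤ 1) :
    Algebra.trdeg K L ≤ 1 := by
  rw [← trdeg_add_eq K E (A := L), trdeg_eq_zero (R := E), add_zero]
  exact h

open scoped IntermediateField.algebraAdjoinAdjoin in

theorem trdeg_closure_le {K Ω : Type u} [Field K] [Field Ω] [Algebra K Ω] (ψ : Ω) :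
    Algebra.trdeg K ((algebraicClosure (IntermediateField.adjoin K {ψ}) Ω).restrictScalars K) ≤ 1 := by
  let E := IntermediateField.adjoin K {ψ}
  let Λ := algebraicClosure E Ω
  change Algebra.trdeg K Λ ≤ 1
  let S := Algebra.adjoin K {ψ}
  have h1 : Algebra.trdeg K S ≤ 1 := by
    rw [← Polynomial.trdeg_of_isDomain (R := K)]
    have hmem : ∀ p : K[X], aeval ψ p ∈ S := fun p => by
      rw [show S = (aeval ψ).range from Algebra.adjoin_singleton_eq_range_aeval K ψ]
      exact ⟨p, rfl⟩
    refine trdeg_le_of_surjective ((aeval ψ).codRestrict S hmem) ?_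
    rintro ⟨x, hx⟩
    have hx' := hx
    rw [show S = (aeval ψ).range from Algebra.adjoin_singleton_eq_range_aeval K ψ] at hx'
    obtain ⟨p, hp⟩ := hx'
    exact ⟨p, Subtype.ext hp⟩
  have h2 : Algebra.trdeg S E = 0 := by
    have : Algebra.IsAlgebraic S E := IsLocalization.isAlgebraic E (nonZeroDivisors S)
    exact trdeg_eq_zero
  have h3 : Algebra.trdeg K E ≤ 1 := by
    rw [← trdeg_add_eq K S (A := E), h2, add_zero]
    exact h1
  exact trdeg_le_of_alg (E := E) h3

theorem core {K Ω : Type u} [Field K] [Field Ω] [Algebra K Ω] [IsAlgClosed Ω]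
    {ι : Type*} [Finite ι] [Nonempty ι]
    (A : ι → Subalgebra K Ω) (hA : ∀ i, (A i).FG)
    (hfrac : ∀ i j, ∀ a ∈ A j, ∃ s ∈ A i, s ≠ 0 ∧ s * a ∈ A i)
    (halg : ∀ i, Algebra.IsAlgebraic (A i) Ω) (htr : 2 ≤ Algebra.trdeg K Ω)
    (m : ∀ i, Ideal (A i)) (hm : ∀ i, (m i).IsMaximal) :
    ∃ (D : Subalgebra K Ω) (hAD : ∀ i, A i ≤ D) (Q : Ideal D), Q.IsPrime ∧ Q ≠ ⊥ ∧
      ∀ i (a : A i), Subalgebra.inclusion (hAD i) a ∈ Q → a ∈ m i := by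
  have h1 := fun i => exists_good_val (A i) (hA i) htr (m i)
  choose V φ hφ hAV hmV using h1
  obtain ⟨ψ, hψ⟩ := exists_common_good V φ hφ
  let E := IntermediateField.adjoin K {ψ}
  let Λ' := algebraicClosure E Ω
  let Λ : IntermediateField K Ω := Λ'.restrictScalars K
  have hcl : IsAlgClosed Λ' := IsAlgClosure.isAlgClosed E
  have : IsAlgClosed Λ := hcl
  obtain ⟨i0⟩ := ‹Nonempty ι›
  have hψt : Transcendental K ψ := by
    rintro ⟨p, hp, hp0⟩
    have := hψ i0 p hp
    rw [hp0] at this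
    simp at this
  have hEV : ∀ i, ∀ x ∈ E, (V i).valuation x ≤ 1 := by
    intro i x hx
    obtain ⟨r, s, rfl⟩ := (IntermediateField.mem_adjoin_simple_iff K x).mp hx
    by_cases hs : s = 0
    · simp [hs]
    by_cases hr : r = 0
    · simp [hr]
    rw [map_div₀, hψ i r hr, hψ i s hs, div_one]
  have hΛle : ∀ i, ∀ x ∈ Λ, (V i).valuation x ≤ 1 := by
    intro i x hx
    have hx' : IsIntegral E x := (mem_algebraicClosure_iff.mp hx).isIntegral
    let j : E →+* (V i) := E.toSubring.subtype.codRestrict (V i).toSubring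
      (fun e => ((V i).valuation_le_one_iff _).mp (hEV i _ e.2))
    have : IsIntegral (V i) x := by
      obtain ⟨p, hp, hp0⟩ := hx'
      refine ⟨p.map j, hp.map j, ?_⟩
      rw [Polynomial.eval₂_map]
      exact hp0
    obtain ⟨y, rfl⟩ := IsIntegrallyClosed.isIntegral_iff.mp this
    exact ((V i).valuation_le_one_iff _).mpr y.2
  have hΛV : ∀ i, ∀ l ∈ Λ, l ≠ 0 → (V i).valuation l = 1 := by
    intro i l hl hl0
    refine le_antisymm (hΛle i l hl) ?_
    have h2 := hΛle i l⁻¹ (Λ.inv_mem hl)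
    rw [map_inv₀] at h2
    exact (inv_le_one₀ (zero_lt_iff.mpr ((Valuation.ne_zero_iff _).mpr hl0))).mp h2
  have hψΛ : ψ ∈ Λ := Λ'.algebraMap_mem (⟨ψ, IntermediateField.mem_adjoin_simple_self K ψ⟩ : E)
  have : Nonempty ι := ⟨i0⟩
  exact core2 A hA hfrac halg V m hm (fun i a ha => hAV i ⟨a, ha⟩) hmV Λ hΛV ψ hψΛ hψt
    (trdeg_closure_le ψ)
end ModT

end AlgPart

section ModU

theorem trdeg_two {K B : Type u} [Field K] [CommRing B] [IsDomain B] [Algebra K B]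
    [Algebra.FiniteType K B] (p q : Ideal B) (hp : p.IsPrime) (hp0 : p ≠ ⊥) (hq : q.IsPrime) (hpq : p < q) :
    2 ≤ Algebra.trdeg K B := by
  by_contra h
  have h1 : Algebra.trdeg K B ≤ 1 := by
    rw [Cardinal.two_le_iff_one_lt, not_lt] at h
    exact h
  have hnm : ¬ p.IsMaximal := fun hm => hq.ne_top (hm.1.2 q hpq)
  by_cases ht : ∃ φ : B, Transcendental K φ
  · obtain ⟨φ, hφ⟩ := ht
    exact hnm ((curve_ring K B h1 φ hφ).1 p hp hp0)
  · push Not at ht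
    have halg : Algebra.IsAlgebraic K B := ⟨fun x => by
      have := ht x
      rwa [Transcendental, not_not] at this⟩
    have hintegral : Algebra.IsIntegral K B := inferInstance
    have hf : IsField B := isField_of_isIntegral_of_isField' (Field.toIsField K)
    apply hnm
    let := hf.toField
    exact absurd hp.ne_top (by
      rcases Ideal.eq_bot_or_top p with h | h
      · exact absurd h hp0
      · exact not_not.mpr h)

theorem core_rings {K F : Type u} [Field K] [Field F] [Algebra K F] {ι : Type} [Finite ι] [Nonempty ι]
    (htr : 2 ≤ Algebra.trdeg K F)
    (R : ι → Type u) [∀ i, CommRing (R i)] [∀ i, IsDomain (R i)] [∀ i, Algebra K (R i)]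
    [∀ i, Algebra (R i) F] [∀ i, IsScalarTower K (R i) F] [∀ i, Algebra.FiniteType K (R i)]
    [∀ i, IsFractionRing (R i) F] (p : ∀ i, Ideal (R i)) (hp : ∀ i, (p i).IsMaximal) :
    ∃ (D : Type u) (_ : CommRing D) (_ : IsDomain D) (_ : Algebra K D) (Ω : Type u) (_ : Field Ω) (e : F →+* Ω)
      (j : D →+* Ω) (_ : Function.Injective j) (γ : ∀ i, R i →+* D) (Q : Ideal D) (_ : Q.IsPrime),
      (∀ i, j.comp (γ i) = e.comp (algebraMap (R i) F)) ∧
      (∀ i, (γ i).comp (algebraMap K (R i)) = algebraMap K D) ∧ (∀ i, Q.comap (γ i) ≤ p i) ∧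
      ∀ i, Q.comap (γ i) ≠ ⊥ := by
  let Ω := AlgebraicClosure F
  let e : ∀ i, R i →ₐ[K] Ω := fun i => (IsScalarTower.toAlgHom K F Ω).comp (IsScalarTower.toAlgHom K (R i) F)
  have hinj : ∀ i, Function.Injective (e i) := fun i =>
    (algebraMap F Ω).injective.comp (IsFractionRing.injective (R i) F)
  let A : ι → Subalgebra K Ω := fun i => (e i).range
  have hA : ∀ i, (A i).FG := by
    intro i
    rw [show A i = (⊤ : Subalgebra K (R i)).map (e i) from (Algebra.map_top _).symm]
    exact Subalgebra.FG.map _ (Algebra.FiniteType.out)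
  have hfrac : ∀ i j, ∀ a ∈ A j, ∃ s ∈ A i, s ≠ 0 ∧ s * a ∈ A i := by
    rintro i j _ ⟨a, rfl⟩
    obtain ⟨x, y, hy, hxy⟩ := IsFractionRing.div_surjective (A := R i) (algebraMap (R j) F a)
    have hy0 : y ≠ 0 := nonZeroDivisors.ne_zero hy
    refine ⟨e i y, ⟨y, rfl⟩, ?_, ⟨x, ?_⟩⟩
    · rw [Ne, map_eq_zero_iff _ (hinj i)]; exact hy0
    · have hy1 : algebraMap (R i) F y ≠ 0 := by
        rwa [Ne, map_eq_zero_iff _ (IsFractionRing.injective (R i) F)]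
      change algebraMap F Ω (algebraMap (R i) F x) = algebraMap F Ω (algebraMap (R i) F y) *
        algebraMap F Ω (algebraMap (R j) F a)
      rw [← hxy, ← map_mul, mul_div_cancel₀ _ hy1]
  have halg : ∀ i, Algebra.IsAlgebraic (A i) Ω := by
    intro i
    have h1 : Algebra.IsAlgebraic (R i) F := IsLocalization.isAlgebraic F (nonZeroDivisors (R i))
    have h2 : Algebra.IsAlgebraic (R i) Ω := Algebra.IsAlgebraic.trans (R i) F Ω
    let : Algebra (R i) (A i) := (e i).rangeRestrict.toRingHom.toAlgebra
    have : IsScalarTower (R i) (A i) Ω := IsScalarTower.of_algebraMap_eq (fun _ => rfl)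
    refine Algebra.IsAlgebraic.extendScalars (R := R i) (S := A i) ?_
    intro x y hxy
    exact hinj i (congrArg Subtype.val hxy)
  have htrΩ : 2 ≤ Algebra.trdeg K Ω :=
    htr.trans (trdeg_le_of_injective (IsScalarTower.toAlgHom K F Ω) (algebraMap F Ω).injective)
  let E : ∀ i, R i ≃ₐ[K] A i := fun i => AlgEquiv.ofInjective (e i) (hinj i)
  have hE : ∀ i x, ((E i x : A i) : Ω) = e i x := fun i x => rfl
  let m : ∀ i, Ideal (A i) := fun i => (p i).comap (E i).symm
  have hm : ∀ i, (m i).IsMaximal := fun i =>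
    Ideal.comap_isMaximal_of_surjective _ (E i).symm.surjective
  obtain ⟨D, hAD, Q, hQ, hQ0, hQm⟩ := core A hA hfrac halg htrΩ m hm
  refine ⟨D, inferInstance, inferInstance, inferInstance, Ω, inferInstance, algebraMap F Ω,
    D.val.toRingHom, Subtype.val_injective,
    fun i => ((Subalgebra.inclusion (hAD i)).comp (E i).toAlgHom).toRingHom, Q, hQ, ?_, ?_, ?_, ?_⟩
  · intro i
    ext x
    rfl
  · intro i
    exact AlgHom.comp_algebraMap ((Subalgebra.inclusion (hAD i)).comp (E i).toAlgHom)
  · intro i x hx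
    have h := hQm i (E i x) hx
    change (E i).symm (E i x) ∈ p i at h
    rwa [AlgEquiv.symm_apply_apply] at h
  · intro i hbot
    apply hQ0
    have h1 : Q.comap (Subalgebra.inclusion (hAD i)) = ⊥ := by
      rw [eq_bot_iff]
      intro x hx
      obtain ⟨y, rfl⟩ := (E i).surjective x
      have : y ∈ (⊥ : Ideal (R i)) := by rw [← hbot]; exact hx
      rw [Ideal.mem_bot] at this ⊢
      rw [this, map_zero]
    let : Algebra (A i) D := (Subalgebra.inclusion (hAD i)).toRingHom.toAlgebra
    have : IsScalarTower (A i) D Ω := IsScalarTower.of_algebraMap_eq (fun _ => rfl)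
    rw [eq_bot_iff]
    intro x hx
    rw [Ideal.mem_bot]
    by_contra hx0
    have hxa : IsAlgebraic (A i) x := by
      have := (halg i).1 (x : Ω)
      exact (isAlgebraic_algebraMap_iff (R := A i) (S := D) (A := Ω) Subtype.val_injective).mp this
    exact Ideal.comap_ne_bot_of_algebraic_mem hx0 hx hxa h1
end ModU

open AlgebraicGeometry CategoryTheory CategoryTheory.Limits

section ModV
open TopologicalSpace

theorem exists_integral_subscheme (X : Scheme.{u}) (C : Closeds X) (hC : IsIrreducible (C : Set X)) :
    ∃ (Y : Scheme.{u}) (i : Y ⟶ X), IsIntegral Y ∧ IsClosedImmersion i ∧ Set.range i = C := by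
  let I := Scheme.IdealSheafData.vanishingIdeal C
  have hr : Set.range I.subschemeι = C := by
    rw [Scheme.IdealSheafData.range_subschemeι]
    simp [I]
  refine ⟨I.subscheme, I.subschemeι, ?_, inferInstance, hr⟩
  have h1 : IrreducibleSpace I.subscheme := by
    have hcl := I.subschemeι.isClosedEmbedding
    let e := hcl.isEmbedding.toHomeomorph
    have : IrreducibleSpace (Set.range I.subschemeι) := Subtype.irreducibleSpace (by rw [hr]; exact hC)
    rw [irreducibleSpace_def, Set.top_eq_univ, ← e.symm.surjective.range_eq, ← Set.image_univ]
    exact (IrreducibleSpace.isIrreducible_univ _).image _ e.symm.continuous.continuousOn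
  have h2 : IsReduced I.subscheme := by
    rw [IsReduced.iff_of_openCover _ I.subschemeCover.openCover]
    intro (U : X.affineOpens)
    have : _root_.IsReduced (Γ(X, U) ⧸ I.ideal U) := by
      rw [← Ideal.isRadical_iff_quotient_reduced]
      simp only [I, Scheme.IdealSheafData.vanishingIdeal_ideal]
      exact PrimeSpectrum.isRadical_vanishingIdeal _
    change IsReduced (Spec (.of (Γ(X, U) ⧸ I.ideal U)))
    infer_instance
  exact isIntegral_of_irreducibleSpace_of_isReduced _

theorem closed_pt {K Kbar : Type u} [Field K] [Field Kbar] [Algebra K Kbar] [Algebra.IsAlgebraic K Kbar]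
    {X : Scheme.{u}} (f : X ⟶ Spec (.of K)) [IsSeparated f] (x : Spec (.of Kbar) ⟶ X)
    (hx : x ≫ f = Spec.map (CommRingCat.ofHom (algebraMap K Kbar))) (y : Spec (.of Kbar)) :
    IsClosed {x y} := by
  have h1 : IsIntegralHom (x ≫ f) := by
    rw [hx, IsIntegralHom.SpecMap_iff]
    change (algebraMap K Kbar).IsIntegral
    exact algebraMap_isIntegral_iff.mpr inferInstance
  have h2 : IsIntegralHom x := .of_comp x f
  have hs : Subsingleton (Spec (.of Kbar)) := inferInstanceAs (Subsingleton (PrimeSpectrum Kbar))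
  have h3 := x.isClosedMap {y} (by 
    rw [show ({y} : Set (Spec (.of Kbar))) = Set.univ from
      Set.eq_univ_of_forall fun z => Subsingleton.elim z y]
    exact isClosed_univ)
  rwa [Set.image_singleton] at h3

theorem integral_case {K : Type u} [Field K] {Y : Scheme.{u}} [IsIntegral Y] (g : Y ⟶ Spec (.of K))
    [LocallyOfFiniteType g] [IsSeparated g] {ι : Type} [Finite ι] [Nonempty ι] (y : ι → Y)
    (hy : ∀ i, IsClosed {y i}) (a b : Y) (ha : a ≠ genericPoint Y) (hab : a ⤳ b) (hba : a ≠ b) :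
    ∃ η : Y, η ≠ genericPoint Y ∧ ∀ i, η ⤳ y i := by
  have hex : ∀ z : Y, ∃ U : Y.Opens, IsAffineOpen U ∧ z ∈ U := fun z => by
    obtain ⟨U, hU, hz, -⟩ := exists_isAffineOpen_mem_and_subset (X := Y) (x := z) (U := ⊤) trivial
    exact ⟨U, hU, hz⟩
  let ξ := genericPoint Y
  have hξ : ∀ (U : Y.Opens) (z : Y), z ∈ U → ξ ∈ U := fun U z hz =>
    ((genericPoint_spec Y).mem_open_set_iff U.isOpen).mpr ⟨z, trivial, hz⟩
  let F := Y.functionField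
  let κF : K →+* F := (Spec.preimage (Y.fromSpecStalk ξ ≫ g)).hom
  let : Algebra K F := κF.toAlgebra
  let κ : ∀ (U : Y.Opens) (_ : IsAffineOpen U), K →+* Γ(Y, U) := fun U hU =>
    (Spec.preimage (hU.fromSpec ≫ g)).hom
  have hκ : ∀ (U : Y.Opens) (hU : IsAffineOpen U), Spec.map (CommRingCat.ofHom (κ U hU)) = hU.fromSpec ≫ g := by
    intro U hU
    exact Spec.map_preimage _
  have hκF : Spec.map (CommRingCat.ofHom κF) = Y.fromSpecStalk ξ ≫ g := Spec.map_preimage _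
  have hft : ∀ (U : Y.Opens) (hU : IsAffineOpen U), (κ U hU).FiniteType := by
    intro U hU
    have h1 : LocallyOfFiniteType (Spec.map (CommRingCat.ofHom (κ U hU))) := by
      rw [hκ]; infer_instance
    exact (HasRingHomProperty.Spec_iff (P := @LocallyOfFiniteType)).mp h1
  have hcomp : ∀ (U : Y.Opens) (hU : IsAffineOpen U) (h : ξ ∈ U),
      (Y.presheaf.germ U ξ h).hom.comp (κ U hU) = κF := by
    intro U hU h
    have : CommRingCat.ofHom (κ U hU) ≫ Y.presheaf.germ U ξ h = CommRingCat.ofHom κF := by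
      apply Spec.map_injective
      rw [Spec.map_comp, hκ, hκF, ← Category.assoc, ← hU.fromSpecStalk_eq_fromSpecStalk h]
      rfl
    exact congrArg (fun t => t.hom) this
  have hbot : ∀ (U : Y.Opens) (hU : IsAffineOpen U) (_ : ξ ∈ U) (q : PrimeSpectrum Γ(Y, U)),
      hU.fromSpec q = ξ → q.asIdeal = ⊥ := by
    intro U hU h q hq
    have : Nonempty U := ⟨⟨ξ, h⟩⟩
    have h1 : hU.fromSpec (hU.primeIdealOf ⟨ξ, h⟩) = ξ := hU.fromSpec_primeIdealOf ⟨ξ, h⟩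
    have h2 : q = hU.primeIdealOf ⟨ξ, h⟩ := hU.fromSpec.isOpenEmbedding.injective (hq.trans h1.symm)
    have h3 : hU.primeIdealOf ⟨ξ, h⟩ = genericPoint (Spec Γ(Y, U)) := hU.primeIdealOf_genericPoint
    rw [h2, h3, genericPoint_eq_bot_of_affine]
    rfl
  have hbot' : ∀ (U : Y.Opens) (hU : IsAffineOpen U) (_ : ξ ∈ U) (q : PrimeSpectrum Γ(Y, U)),
      q.asIdeal = ⊥ → hU.fromSpec q = ξ := by
    intro U hU h q hq
    have h1 : hU.fromSpec (hU.primeIdealOf ⟨ξ, h⟩) = ξ := hU.fromSpec_primeIdealOf ⟨ξ, h⟩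
    rw [← h1]
    congr 1
    apply PrimeSpectrum.ext
    rw [hq, hbot U hU h _ h1]
  have htr : 2 ≤ Algebra.trdeg K F := by
    obtain ⟨U, hU, hb⟩ := hex b
    have haU : a ∈ U := hab.mem_open U.isOpen hb
    have hξU := hξ U b hb
    have : Nonempty U := ⟨⟨ξ, hξU⟩⟩
    let : Algebra K Γ(Y, U) := (κ U hU).toAlgebra
    have : Algebra.FiniteType K Γ(Y, U) := hft U hU
    have ea := hU.fromSpec_primeIdealOf ⟨a, haU⟩
    have eb := hU.fromSpec_primeIdealOf ⟨b, hb⟩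
    have hlt : hU.primeIdealOf ⟨a, haU⟩ < hU.primeIdealOf ⟨b, hb⟩ := by
      refine lt_of_le_of_ne ?_ ?_
      · rw [PrimeSpectrum.le_iff_specializes]
        refine (hU.fromSpec.isOpenEmbedding.isInducing.specializes_iff).mp ?_
        rw [ea, eb]
        exact hab
      · intro h
        rw [h, eb] at ea
        exact hba ea.symm
    have h2 := trdeg_two (K := K) (B := Γ(Y, U)) (hU.primeIdealOf ⟨a, haU⟩).asIdeal
      (hU.primeIdealOf ⟨b, hb⟩).asIdeal inferInstance
      (fun h => ha (ea.symm.trans (hbot' U hU hξU _ h))) inferInstance hlt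
    have : IsScalarTower K Γ(Y, U) F := IsScalarTower.of_algebraMap_eq' (hcomp U hU hξU).symm
    refine h2.trans ?_
    exact trdeg_le_of_injective (IsScalarTower.toAlgHom K Γ(Y, U) F)
      (Y.germToFunctionField_injective U)
  choose U hU hyU using fun i => hex (y i)
  have hξU : ∀ i, ξ ∈ U i := fun i => hξ _ _ (hyU i)
  have : ∀ i, Nonempty (U i) := fun i => ⟨⟨ξ, hξU i⟩⟩
  let : ∀ i, Algebra K Γ(Y, U i) := fun i => (κ (U i) (hU i)).toAlgebra
  have : ∀ i, Algebra.FiniteType K Γ(Y, U i) := fun i => hft _ _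
  have : ∀ i, IsScalarTower K Γ(Y, U i) F := fun i =>
    IsScalarTower.of_algebraMap_eq' (hcomp (U i) (hU i) (hξU i)).symm
  have : ∀ i, IsFractionRing Γ(Y, U i) F := fun i =>
    functionField_isFractionRing_of_isAffineOpen Y (U i) (hU i)
  obtain ⟨D, _, _, _, Ω, _, e, j, hj, γ, Q, hQ, h1, h2, h3, h4⟩ :=
    core_rings (K := K) (F := F) htr (fun i => Γ(Y, U i))
      (fun i => ((hU i).primeIdealOf ⟨y i, hyU i⟩).asIdeal)
      (fun i => (hU i).primeIdealOf_isMaximal_of_isClosed _ (hy i))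
  let h : ι → (Spec (.of D) ⟶ Y) := fun i => Spec.map (CommRingCat.ofHom (γ i)) ≫ (hU i).fromSpec
  have hg : ∀ i, h i ≫ g = Spec.map (CommRingCat.ofHom (algebraMap K D)) := by
    intro i
    simp only [h, Category.assoc]
    rw [← hκ, ← Spec.map_comp, ← h2 i]
    rfl
  have hgen : ∀ i, Spec.map (CommRingCat.ofHom j) ≫ h i =
      Spec.map (CommRingCat.ofHom e) ≫ Y.fromSpecStalk ξ := by
    intro i
    simp only [h]
    rw [← (hU i).fromSpecStalk_eq_fromSpecStalk (hξU i), IsAffineOpen.fromSpecStalk,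
      ← Category.assoc, ← Category.assoc, ← Spec.map_comp, ← CommRingCat.ofHom_comp, h1 i]
    erw [← Spec.map_comp]
    rfl
  have hdom : IsDominant (Spec.map (CommRingCat.ofHom j)) := by
    constructor
    refine PrimeSpectrum.denseRange_comap_iff_ker_le_nilRadical j |>.mpr ?_
    rw [(RingHom.injective_iff_ker_eq_bot j).mp hj]
    exact bot_le
  have heq : ∀ i k, h i = h k := fun i k =>
    ext_of_isDominant_of_isSeparated g ((hg i).trans (hg k).symm) (Spec.map (CommRingCat.ofHom j))
      ((hgen i).trans (hgen k).symm)
  let q : PrimeSpectrum D := ⟨Q, hQ⟩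
  have hη : ∀ i, h i q = (hU i).fromSpec (PrimeSpectrum.comap (γ i) q) := fun i => rfl
  let i0 : ι := Classical.arbitrary ι
  refine ⟨h i0 q, ?_, ?_⟩
  · intro hh
    rw [hη] at hh
    exact h4 i0 (hbot _ (hU i0) (hξU i0) _ hh)
  · intro i
    rw [heq i0 i, hη]
    have e1 := (hU i).fromSpec_primeIdealOf ⟨y i, hyU i⟩
    have e2 : PrimeSpectrum.comap (γ i) q ⤳ (hU i).primeIdealOf ⟨y i, hyU i⟩ := by
      rw [← PrimeSpectrum.le_iff_specializes]
      exact h3 i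
    have e3 := e2.map (hU i).fromSpec.continuous
    rw [e1] at e3
    exact e3
end ModV

section ModW
open TopologicalSpace

theorem dim_eq_one {X : Scheme.{u}} {K : Type u} [Field K] (f : X ⟶ Spec (.of K))
    [LocallyOfFiniteType f] [IsSeparated f] {ι : Type} [Finite ι] (t : ι → X)
    (ht : ∀ i, IsClosed {t i}) (i1 i2 : ι) (h12 : t i1 ≠ t i2)
    (C : Closeds X) (hC : IsIrreducible (C : Set X)) (htC : ∀ i, t i ∈ C)
    (hmin : ∀ C' : Closeds X, IsIrreducible (C' : Set X) → (∀ i, t i ∈ C') → C' ≤ C → C' = C) :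
    topologicalKrullDim (C : Set X) = 1 := by
  obtain ⟨Y, i, hY, hi, hr⟩ := exists_integral_subscheme X C hC
  have : Nonempty ι := ⟨i1⟩
  have hce := i.isClosedEmbedding
  have hdimY : topologicalKrullDim (C : Set X) = topologicalKrullDim Y := by
    rw [← hr]
    exact (hce.isEmbedding.toHomeomorph.isHomeomorph.topologicalKrullDim_eq).symm
  rw [hdimY]
  have hty : ∀ k, ∃ y : Y, i y = t k := fun k => by
    have : t k ∈ Set.range i := by rw [hr]; exact htC k
    exact this
  choose y hy using hty
  have hyc : ∀ k, IsClosed {y k} := fun k => by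
    have : {y k} = i ⁻¹' {t k} := by
      ext z
      simp only [Set.mem_singleton_iff, Set.mem_preimage, ← hy]
      exact hce.injective.eq_iff.symm
    rw [this]
    exact (ht k).preimage i.continuous
  apply le_antisymm
  · unfold topologicalKrullDim
    rw [Order.krullDim_le_one_iff]
    intro Z
    by_contra hcon
    push Not at hcon
    obtain ⟨hn1, hn2⟩ := hcon
    obtain ⟨Z0, hZ0⟩ := not_isMin_iff.mp hn1
    obtain ⟨Z2, hZ2⟩ := not_isMax_iff.mp hn2
    have g0 := Z0.isIrreducible.isGenericPoint_genericPoint Z0.isClosed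
    have g1 := Z.isIrreducible.isGenericPoint_genericPoint Z.isClosed
    have k1 : Z.isIrreducible.genericPoint ≠ genericPoint Y := by
      intro h
      rw [h] at g1
      have : (Z : Set Y) = Set.univ := by rw [← g1.def]; exact (genericPoint_spec Y).def
      refine hZ2.not_ge ?_
      intro z _
      change z ∈ (Z : Set Y)
      rw [this]; trivial
    have k2 : Z.isIrreducible.genericPoint ⤳ Z0.isIrreducible.genericPoint := by
      rw [specializes_iff_mem_closure, g1.def]
      have : Z0.isIrreducible.genericPoint ∈ (Z0 : Set Y) := g0.mem
      exact hZ0.le this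
    have k3 : Z.isIrreducible.genericPoint ≠ Z0.isIrreducible.genericPoint := by
      intro h
      rw [h] at g1
      have : (Z : Set Y) = Z0 := g1.def.symm.trans g0.def
      exact hZ0.ne (SetLike.coe_injective this).symm
    obtain ⟨η, hη, hη'⟩ := integral_case (i ≫ f) y hyc Z.isIrreducible.genericPoint
      Z0.isIrreducible.genericPoint k1 k2 k3
    have hc : (⟨closure {i η}, isClosed_closure⟩ : Closeds X) = C := by
      refine hmin _ isIrreducible_singleton.closure ?_ ?_
      · intro k
        rw [← hy k]
        exact ((hη' k).map i.continuous).mem_closure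
      · intro z hz
        refine closure_minimal ?_ C.isClosed hz
        rintro _ rfl
        change i η ∈ (C : Set X)
        rw [← hr]
        exact ⟨η, rfl⟩
    have h1 : i (genericPoint Y) ∈ closure {i η} := by
      have : i (genericPoint Y) ∈ (C : Set X) := by rw [← hr]; exact ⟨_, rfl⟩
      rw [← hc] at this
      exact this
    have h2 : η ⤳ genericPoint Y := by
      rw [← hce.isInducing.specializes_iff]
      exact specializes_iff_mem_closure.mpr h1
    exact hη (h2.antisymm (genericPoint_specializes η)).eq
  · unfold topologicalKrullDim
    rw [Order.one_le_krullDim_iff]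
    refine ⟨⟨{y i1}, isIrreducible_singleton, hyc i1⟩,
      ⟨Set.univ, IrreducibleSpace.isIrreducible_univ _, isClosed_univ⟩, ?_⟩
    refine lt_of_le_of_ne (fun _ _ => trivial) ?_
    intro h
    have h' : ({y i1} : Set Y) = Set.univ := congrArg (fun Z : IrreducibleCloseds Y => (Z : Set Y)) h
    have : y i2 ∈ ({y i1} : Set Y) := h' ▸ trivial
    apply h12
    rw [← hy, ← hy, Set.mem_singleton_iff.mp this]
end ModW

/-- **Existence of an integral curve through finitely many geometric points**
(Bertini–Charles–Poonen, Theorem A.1(main part)): if `X` is a separated irreducible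
scheme of finite type over a field `K` of Krull dimension at least `1`, and
`x̄ 1, …, x̄ n` are `K̄`-points of `X` over `K`, then there is a closed irreducible
subset `C` of `|X|` of Krull dimension `1` containing the images of all the `x̄ i`. -/
theorem curve_through_points
    (K Kbar : Type u) [Field K] [Field Kbar] [Algebra K Kbar] [IsAlgClosure K Kbar]
    (X : Scheme.{u}) (f : X ⟶ Spec (CommRingCat.of K))
    [QuasiCompact f] [LocallyOfFiniteType f] [IsSeparated f]
    [IrreducibleSpace X] (hdim : 1 ≤ topologicalKrullDim X)
    (n : ℕ) (x : Fin n → (Spec (CommRingCat.of Kbar) ⟶ X))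
    (hx : ∀ i, x i ≫ f = Spec.map (CommRingCat.ofHom (algebraMap K Kbar))) :
    ∃ C : Set X, IsClosed C ∧ IsIrreducible C ∧ topologicalKrullDim C = 1 ∧
      ∀ (i : Fin n) (y : Spec (CommRingCat.of Kbar)), (x i).base y ∈ C := by
  have : Algebra.IsAlgebraic K Kbar := IsAlgClosure.isAlgebraic
  have : IsLocallyNoetherian X := LocallyOfFiniteType.isLocallyNoetherian f
  have : CompactSpace X := QuasiCompact.compactSpace_of_compactSpace f
  have : IsNoetherian X := {}
  have hN : TopologicalSpace.NoetherianSpace X := inferInstance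
  have hJ : JacobsonSpace X := LocallyOfFiniteType.jacobsonSpace f
  have hs : Subsingleton (Spec (.of Kbar)) := inferInstanceAs (Subsingleton (PrimeSpectrum Kbar))
  have hne : Nonempty (Spec (.of Kbar)) := inferInstanceAs (Nonempty (PrimeSpectrum Kbar))
  obtain ⟨pt⟩ := hne
  have hb : ∃ b1 b2 : X, IsClosed {b1} ∧ IsClosed {b2} ∧ b1 ≠ b2 := by
    by_contra! hcon
    have hd : closure (closedPoints X) = Set.univ := by
      have := hJ.closure_inter_closedPoints (Z := Set.univ) isClosed_univ
      simpa using this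
    have hne : (closedPoints X).Nonempty := by
      rw [← closure_nonempty_iff, hd]; exact Set.univ_nonempty
    obtain ⟨b, hb⟩ := hne
    have hsub : closedPoints X = {b} := by
      ext z
      constructor
      · intro hz; exact hcon z b hz hb
      · rintro rfl; exact hb
    rw [hsub, IsClosed.closure_eq hb] at hd
    unfold topologicalKrullDim at hdim
    rw [Order.one_le_krullDim_iff] at hdim
    obtain ⟨Z1, Z2, hZ⟩ := hdim
    refine hZ.not_ge ?_
    intro z _
    obtain ⟨w, hw⟩ := Z1.isIrreducible.nonempty
    have hz : z = b := by have : z ∈ ({b} : Set X) := hd ▸ trivial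
                          exact this
    have hw' : w = b := by have : w ∈ ({b} : Set X) := hd ▸ trivial
                           exact this
    rw [hz, ← hw']
    exact hw
  obtain ⟨b1, b2, hb1, hb2, hb12⟩ := hb
  let t : Fin n ⊕ Bool → X := Sum.elim (fun i => x i pt) (fun c => if c then b1 else b2)
  have ht : ∀ i, IsClosed {t i} := by
    rintro (i | (_ | _))
    · exact closed_pt f (x i) (hx i) pt
    · exact hb2
    · exact hb1
  let S : Set (TopologicalSpace.Closeds X) := {C | IsIrreducible (C : Set X) ∧ ∀ i, t i ∈ C}
  have hS : S.Nonempty := ⟨⊤, by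
    refine ⟨IrreducibleSpace.isIrreducible_univ X, fun _ => trivial⟩⟩
  have hwf : WellFoundedLT (TopologicalSpace.Closeds X) := inferInstance
  obtain ⟨C, hCS, hCmin⟩ := hwf.wf.has_min S hS
  refine ⟨C, C.isClosed, hCS.1, ?_, ?_⟩
  · refine dim_eq_one f t ht (Sum.inr true) (Sum.inr false) hb12 C hCS.1 hCS.2 ?_
    intro C' h1 h2 h3
    by_contra hne
    exact hCmin C' ⟨h1, h2⟩ (lt_of_le_of_ne h3 hne)
  · intro i y
    rw [Subsingleton.elim y pt]
    exact hCS.2 (Sum.inl i)
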